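/- Let (G, C0, φ0) be a minimal counterexample to the extension theorem, with G embedded in the plane so that C0 bounds the outer face. Let f1 be a 6-face and f2 a face of length at most 5 of G (both distinct from the outer face). If f1 and f2 share a common edge xy, then they are normally adjacent (share exactly the edge xy and exactly the two vertices x and y), the subgraph of G induced by V(f1) ∪ V(f2) is a cycle with a unique chord, and no vertex of V(f1) \ {x, y} is contained in a cycle of length at most 5. -/

import Mathlib

open SimpleGraph

namespace IFPaper

variable {V : Type}

/-- An `(I,F)`-coloring of a graph, encoded as a Boolean coloring where
`true` means color `I` and `false` means color `F`:  the `I`-colored vertices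
form an independent set and the `F`-colored vertices induce a forest
(no cycle has all of its vertices colored `F`). -/
def IFColoring (G : SimpleGraph V) (c : V → Bool) : Prop :=
  (∀ ⦃u v : V⦄, G.Adj u v → c u = true → c v = false) ∧
  (∀ (v : V) (w : G.Walk v v), w.IsCycle → ¬ (∀ x ∈ w.support, c x = false))

/-- A graph is `(I,F)`-colorable if it admits an `(I,F)`-coloring. -/
def IFColorable (G : SimpleGraph V) : Prop := ∃ c : V → Bool, IFColoring G c

/-- An `(I,F)`-coloring of the subgraph of `G` induced on the set `S`. -/
def IFColoringOn (G : SimpleGraph V) (S : Set V) (c : V → Bool) : Prop :=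
  (∀ ⦃u v : V⦄, u ∈ S → v ∈ S → G.Adj u v → c u = true → c v = false) ∧
  (∀ (v : V) (w : G.Walk v v), w.IsCycle → (∀ x ∈ w.support, x ∈ S) →
    ¬ (∀ x ∈ w.support, c x = false))

/-- A splitting `F`-path of (the vertex set `Q` of) a cycle: a path all of whose
vertices get color `F`, whose two endpoints lie on `Q`, and all of whose other
vertices (at least one) do not lie on `Q`. -/
def IsSplittingFPath (G : SimpleGraph V) (Q : Set V) (c : V → Bool)
    {a b : V} (p : G.Walk a b) : Prop :=
  p.IsPath ∧ (∀ x ∈ p.support, c x = false) ∧ a ∈ Q ∧ b ∈ Q ∧ 2 ≤ p.length ∧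
  ∀ x ∈ p.support, x ≠ a → x ≠ b → x ∉ Q

/-- A super IF-coloring of `(G, Q)`: an `(I,F)`-coloring of `G` with no
splitting `F`-path of `Q`. -/
def SuperIFColoring (G : SimpleGraph V) (Q : Set V) (c : V → Bool) : Prop :=
  IFColoring G c ∧ ∀ (a b : V) (p : G.Walk a b), ¬ IsSplittingFPath G Q c p

/-- `d* ≥ 3`: any two distinct cycles of length at most `5` are at distance at
least `3`. -/
def Cycles5Apart (G : SimpleGraph V) : Prop :=
  ∀ ⦃u v : V⦄ (c1 : G.Walk u u) (c2 : G.Walk v v),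
    c1.IsCycle → c2.IsCycle → c1.length ≤ 5 → c2.length ≤ 5 →
    {e : Sym2 V | e ∈ c1.edges} ≠ {e : Sym2 V | e ∈ c2.edges} →
    ∀ x ∈ c1.support, ∀ y ∈ c2.support, 3 ≤ G.dist x y

/-- A claw of the cycle `C`: a vertex not on `C` with three neighbors on `C`. -/
def HasClaw (G : SimpleGraph V) {v : V} (C : G.Walk v v) : Prop :=
  ∃ x : V, x ∉ C.support ∧ ∃ a b c : V, a ∈ C.support ∧ b ∈ C.support ∧ c ∈ C.support ∧
    a ≠ b ∧ a ≠ c ∧ b ≠ c ∧ G.Adj x a ∧ G.Adj x b ∧ G.Adj x c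

/-- A triclaw of the cycle `C`: a triangle `x y z` disjoint from `C`, joined by
three edges to three distinct vertices of `C`. -/
def HasTriclaw (G : SimpleGraph V) {v : V} (C : G.Walk v v) : Prop :=
  ∃ x y z : V, x ∉ C.support ∧ y ∉ C.support ∧ z ∉ C.support ∧
    G.Adj x y ∧ G.Adj y z ∧ G.Adj x z ∧
    ∃ a b c : V, a ∈ C.support ∧ b ∈ C.support ∧ c ∈ C.support ∧
      a ≠ b ∧ a ≠ c ∧ b ≠ c ∧ G.Adj x a ∧ G.Adj y b ∧ G.Adj z c

/-- A bad cycle is a `9`-cycle having a claw or a triclaw. -/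
def IsBadCycle (G : SimpleGraph V) {v : V} (C : G.Walk v v) : Prop :=
  C.IsCycle ∧ C.length = 9 ∧ (HasClaw G C ∨ HasTriclaw G C)

/-- A good cycle is a cycle that is not bad. -/
def IsGoodCycle (G : SimpleGraph V) {v : V} (C : G.Walk v v) : Prop :=
  C.IsCycle ∧ ¬ IsBadCycle G C

/-- The interior of an arc parametrized by `[0,1]`. -/
def ArcInterior (γ : ℝ → ℝ × ℝ) : Set (ℝ × ℝ) := γ '' Set.Ioo 0 1

/-- The image of an arc parametrized by `[0,1]`. -/
def ArcImage (γ : ℝ → ℝ × ℝ) : Set (ℝ × ℝ) := γ '' Set.Icc 0 1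

/-- A plane embedding of a simple graph: an injective placement of the vertices
in the plane together with, for every edge, a simple arc joining the images of
its endpoints, such that arcs meet only at common endpoints and no arc passes
through a vertex. -/
structure IsPlaneEmbedding (G : SimpleGraph V) (vtx : V → ℝ × ℝ)
    (arc : V → V → ℝ → ℝ × ℝ) : Prop where
  vtx_inj : Function.Injective vtx
  arc_cont : ∀ ⦃u v : V⦄, G.Adj u v → ContinuousOn (arc u v) (Set.Icc 0 1)
  arc_injOn : ∀ ⦃u v : V⦄, G.Adj u v → Set.InjOn (arc u v) (Set.Icc 0 1)
  arc_start : ∀ ⦃u v : V⦄, G.Adj u v → arc u v 0 = vtx u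
  arc_end : ∀ ⦃u v : V⦄, G.Adj u v → arc u v 1 = vtx v
  arc_symm : ∀ ⦃u v : V⦄, G.Adj u v → ∀ t : ℝ, arc v u t = arc u v (1 - t)
  arc_avoids_vtx : ∀ ⦃u v : V⦄, G.Adj u v → ∀ w : V, vtx w ∉ ArcInterior (arc u v)
  arc_disjoint : ∀ ⦃u v u' v' : V⦄, G.Adj u v → G.Adj u' v' → s(u, v) ≠ s(u', v') →
    ArcInterior (arc u v) ∩ ArcInterior (arc u' v') = ∅

/-- A graph is planar if it admits a plane embedding. -/
def IsPlanarGraph (G : SimpleGraph V) : Prop :=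
  ∃ (vtx : V → ℝ × ℝ) (arc : V → V → ℝ → ℝ × ℝ), IsPlaneEmbedding G vtx arc

/-- The subset of the plane covered by a plane drawing of `G`. -/
def Drawing (G : SimpleGraph V) (vtx : V → ℝ × ℝ) (arc : V → V → ℝ → ℝ × ℝ) :
    Set (ℝ × ℝ) :=
  Set.range vtx ∪ ⋃ (u : V) (v : V) (_ : G.Adj u v), ArcImage (arc u v)

/-- The subset of the plane covered by the drawing of a walk `w`. -/
def WalkDrawing (G : SimpleGraph V) (arc : V → V → ℝ → ℝ × ℝ)
    {a b : V} (w : G.Walk a b) : Set (ℝ × ℝ) :=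
  ⋃ (u : V) (v : V) (_ : G.Adj u v) (_ : s(u, v) ∈ w.edges), ArcImage (arc u v)

/-- A face of a plane drawing: a connected component of the complement of the
drawing. -/
def IsFace (G : SimpleGraph V) (vtx : V → ℝ × ℝ) (arc : V → V → ℝ → ℝ × ℝ)
    (f : Set (ℝ × ℝ)) : Prop :=
  ∃ p : ℝ × ℝ, p ∉ Drawing G vtx arc ∧
    f = connectedComponentIn (Drawing G vtx arc)ᶜ p

/-- The outer face: the unbounded face. -/
def IsOuterFace (G : SimpleGraph V) (vtx : V → ℝ × ℝ) (arc : V → V → ℝ → ℝ × ℝ)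
    (f : Set (ℝ × ℝ)) : Prop :=
  IsFace G vtx arc f ∧ ¬ Bornology.IsBounded f

/-- A vertex is on a face if its image lies on the boundary of the face. -/
def VertexOnFace (vtx : V → ℝ × ℝ) (f : Set (ℝ × ℝ)) (v : V) : Prop :=
  vtx v ∈ frontier f

/-- The face `f` is bounded by the (closed) walk `w`. -/
def FaceBoundedBy (G : SimpleGraph V) (vtx : V → ℝ × ℝ) (arc : V → V → ℝ → ℝ × ℝ)
    (f : Set (ℝ × ℝ)) {a : V} (w : G.Walk a a) : Prop :=
  IsFace G vtx arc f ∧ frontier f = WalkDrawing G arc w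

/-- A vertex lies (strictly) inside the cycle `C` of the plane graph. -/
def VertexInsideCycle (G : SimpleGraph V) (vtx : V → ℝ × ℝ)
    (arc : V → V → ℝ → ℝ × ℝ) {a : V} (C : G.Walk a a) (v : V) : Prop :=
  vtx v ∉ WalkDrawing G arc C ∧
  Bornology.IsBounded (connectedComponentIn (WalkDrawing G arc C)ᶜ (vtx v))

/-- A vertex lies (strictly) outside the cycle `C` of the plane graph. -/
def VertexOutsideCycle (G : SimpleGraph V) (vtx : V → ℝ × ℝ)
    (arc : V → V → ℝ → ℝ × ℝ) {a : V} (C : G.Walk a a) (v : V) : Prop :=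
  vtx v ∉ WalkDrawing G arc C ∧
  ¬ Bornology.IsBounded (connectedComponentIn (WalkDrawing G arc C)ᶜ (vtx v))

/-- A cycle of a plane graph is separating if its interior and its exterior
each contain a vertex of the graph. -/
def IsSeparatingCycle (G : SimpleGraph V) (vtx : V → ℝ × ℝ)
    (arc : V → V → ℝ → ℝ × ℝ) {a : V} (C : G.Walk a a) : Prop :=
  (∃ v : V, VertexInsideCycle G vtx arc C v) ∧
  (∃ v : V, VertexOutsideCycle G vtx arc C v)

/-- The cycle `C` has no chord in `G`. -/
def Chordless (G : SimpleGraph V) {a : V} (C : G.Walk a a) : Prop :=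
  ∀ ⦃u v : V⦄, u ∈ C.support → v ∈ C.support → G.Adj u v → s(u, v) ∈ C.edges

/-- The precoloring `c0` of the cycle `C0` extends to a super IF-coloring of
`(G, C0)`. -/
def ExtendsToSuper (G : SimpleGraph V) {v0 : V} (C0 : G.Walk v0 v0)
    (c0 : V → Bool) : Prop :=
  ∃ c : V → Bool, SuperIFColoring G {x | x ∈ C0.support} c ∧
    ∀ x ∈ C0.support, c x = c0 x

/-- A counterexample to the extension theorem: a planar graph with `d* ≥ 3`, a
good cycle `C0` of length at most `9`, and an `(I,F)`-coloring of `G[V(C0)]`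
which does not extend to a super IF-coloring of `(G, C0)`. -/
def IsCounterexample (G : SimpleGraph V) {v0 : V} (C0 : G.Walk v0 v0)
    (c0 : V → Bool) : Prop :=
  IsPlanarGraph G ∧ Cycles5Apart G ∧ IsGoodCycle G C0 ∧ C0.length ≤ 9 ∧
  IFColoringOn G {x | x ∈ C0.support} c0 ∧ ¬ ExtendsToSuper G C0 c0

/-- The quantity `|V(G)| + |E(G)|`. -/
noncomputable def graphSize {V : Type} [Fintype V] (G : SimpleGraph V) : ℕ :=
  Fintype.card V + G.edgeSet.ncard

/-- A minimal counterexample to the extension theorem: one minimizing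
`|V(G)| + |E(G)|` among all counterexamples. -/
def IsMinimalCounterexample [Fintype V] (G : SimpleGraph V) {v0 : V}
    (C0 : G.Walk v0 v0) (c0 : V → Bool) : Prop :=
  IsCounterexample G C0 c0 ∧
  ∀ (n : ℕ) (G' : SimpleGraph (Fin n)) (v0' : Fin n) (C0' : G'.Walk v0' v0')
    (c0' : Fin n → Bool), IsCounterexample G' C0' c0' →
      graphSize G ≤ graphSize G'

/-- A chord of the cycle `C` splitting it into two cycles of lengths `l1` and
`l2`: an edge between two non-consecutive vertices of `C` together with two
cycles of lengths `l1` and `l2` which both use the chord, use otherwise only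
edges of `C`, and together partition the edges of `C`. -/
def HasChordSplit (G : SimpleGraph V) {a : V} (C : G.Walk a a) (l1 l2 : ℕ) : Prop :=
  ∃ u v : V, u ∈ C.support ∧ v ∈ C.support ∧ G.Adj u v ∧ s(u, v) ∉ C.edges ∧
    ∃ (c1 c2 : G.Walk u u), c1.IsCycle ∧ c2.IsCycle ∧
      c1.length = l1 ∧ c2.length = l2 ∧
      s(u, v) ∈ c1.edges ∧ s(u, v) ∈ c2.edges ∧
      (∀ e ∈ c1.edges, e ≠ s(u, v) → e ∈ C.edges) ∧
      (∀ e ∈ c2.edges, e ≠ s(u, v) → e ∈ C.edges) ∧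
      (∀ e ∈ C.edges, (e ∈ c1.edges ↔ e ∉ c2.edges))

/-- A `(l1, l2, l3)`-claw of the cycle `C`: a claw which together with `C`
forms three cycles of lengths `l1`, `l2` and `l3`. -/
def HasClawSplit (G : SimpleGraph V) {a : V} (C : G.Walk a a) (l1 l2 l3 : ℕ) : Prop :=
  ∃ x : V, x ∉ C.support ∧ ∃ v1 v2 v3 : V,
    v1 ∈ C.support ∧ v2 ∈ C.support ∧ v3 ∈ C.support ∧
    v1 ≠ v2 ∧ v1 ≠ v3 ∧ v2 ≠ v3 ∧ G.Adj x v1 ∧ G.Adj x v2 ∧ G.Adj x v3 ∧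
    ∃ (w1 w2 w3 : G.Walk x x), w1.IsCycle ∧ w2.IsCycle ∧ w3.IsCycle ∧
      w1.length = l1 ∧ w2.length = l2 ∧ w3.length = l3 ∧
      (∀ e ∈ w1.edges, e ∈ C.edges ∨ e = s(x, v1) ∨ e = s(x, v2) ∨ e = s(x, v3)) ∧
      (∀ e ∈ w2.edges, e ∈ C.edges ∨ e = s(x, v1) ∨ e = s(x, v2) ∨ e = s(x, v3)) ∧
      (∀ e ∈ w3.edges, e ∈ C.edges ∨ e = s(x, v1) ∨ e = s(x, v2) ∨ e = s(x, v3)) ∧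
      (∀ e ∈ C.edges, (e ∈ w1.edges ∧ e ∉ w2.edges ∧ e ∉ w3.edges) ∨
        (e ∉ w1.edges ∧ e ∈ w2.edges ∧ e ∉ w3.edges) ∨
        (e ∉ w1.edges ∧ e ∉ w2.edges ∧ e ∈ w3.edges))

/-- A special `9`-cycle: a `9`-cycle having a `(3,8)`-chord or a
`(5,5,5)`-claw. -/
def IsSpecial9Cycle (G : SimpleGraph V) {a : V} (C : G.Walk a a) : Prop :=
  C.IsCycle ∧ C.length = 9 ∧ (HasChordSplit G C 3 8 ∨ HasClawSplit G C 5 5 5)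

/-- Two cycles are normally adjacent if they share exactly one edge and
exactly two vertices. -/
def NormallyAdjacent (G : SimpleGraph V) {a b : V}
    (c1 : G.Walk a a) (c2 : G.Walk b b) : Prop :=
  (∃ e : Sym2 V, {e' : Sym2 V | e' ∈ c1.edges} ∩ {e' : Sym2 V | e' ∈ c2.edges} = {e}) ∧
  (∃ x y : V, x ≠ y ∧ {z : V | z ∈ c1.support} ∩ {z : V | z ∈ c2.support} = {x, y})

/-- A `3`-fold cover `(H, L)` of `G`. -/
def IsDPCover (G : SimpleGraph V) {W : Type} (H : SimpleGraph W)
    (L : V → Finset W) : Prop :=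
  (∀ v : V, (L v).card = 3) ∧
  (∀ ⦃u v : V⦄, u ≠ v → Disjoint (L u) (L v)) ∧
  (∀ v : V, ∀ a ∈ L v, ∀ b ∈ L v, ¬ H.Adj a b) ∧
  (∀ ⦃a b : W⦄, H.Adj a b → ∃ u v : V, G.Adj u v ∧ a ∈ L u ∧ b ∈ L v) ∧
  (∀ ⦃u v : V⦄, u ≠ v → ∀ a ∈ L u, ∀ b ∈ L v, ∀ b' ∈ L v,
    H.Adj a b → H.Adj a b' → b = b')

/-- `G` is DP-`3`-colorable: for every `3`-fold cover `(H, L)` of `G` there is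
an independent transversal picking one vertex from each fiber. -/
def DP3Colorable (G : SimpleGraph V) : Prop :=
  ∀ (W : Type) (H : SimpleGraph W) (L : V → Finset W), IsDPCover G H L →
    ∃ f : V → W, (∀ v : V, f v ∈ L v) ∧ ∀ u v : V, ¬ H.Adj (f u) (f v)

/-- `f` has a continuous logarithm on `K`. -/
def HasLogOn {Y : Type*} [TopologicalSpace Y] (f : Y → ℂ) (K : Set Y) : Prop :=
  ∃ g : Y → ℂ, ContinuousOn g K ∧ ∀ z ∈ K, Complex.exp (g z) = f z

namespace HasLogOn

variable {X Y : Type*} [TopologicalSpace X] [TopologicalSpace Y] {f f' : Y → ℂ} {K L : Set Y}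

lemma congr (h : HasLogOn f K) (hf : ∀ z ∈ K, f z = f' z) : HasLogOn f' K := by
  obtain ⟨g, hg, he⟩ := h
  exact ⟨g, hg, fun z hz => (he z hz).trans (hf z hz)⟩

lemma mul (h : HasLogOn f K) (h' : HasLogOn f' K) : HasLogOn (fun z => f z * f' z) K := by
  obtain ⟨g, hg, he⟩ := h
  obtain ⟨g', hg', he'⟩ := h'
  exact ⟨fun z => g z + g' z, hg.add hg', fun z hz => by
    rw [Complex.exp_add, he z hz, he' z hz]⟩

lemma const {c : ℂ} (hc : c ≠ 0) : HasLogOn (fun _ => c) K :=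
  ⟨fun _ => Complex.log c, continuousOn_const, fun _ _ => Complex.exp_log hc⟩

lemma of_slitPlane (hf : ContinuousOn f K) (h : ∀ z ∈ K, f z ∈ Complex.slitPlane) :
    HasLogOn f K :=
  ⟨fun z => Complex.log (f z), hf.clog h, fun z hz =>
    Complex.exp_log (Complex.slitPlane_ne_zero (h z hz))⟩

lemma inv (h : HasLogOn f K) : HasLogOn (fun z => (f z)⁻¹) K := by
  obtain ⟨g, hg, he⟩ := h
  exact ⟨fun z => -g z, hg.neg, fun z hz => by rw [Complex.exp_neg, he z hz]⟩

/-- In a family of nonvanishing functions on a compact set, parametrized continuously by a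
preconnected space, the quotient of any two members has a continuous logarithm. -/
theorem div_of_preconnectedSpace [PreconnectedSpace X] (hK : IsCompact K) {Φ : X → Y → ℂ}
    (hc : ContinuousOn (fun w : X × Y => Φ w.1 w.2) (Set.univ ×ˢ K))
    (h0 : ∀ s, ∀ z ∈ K, Φ s z ≠ 0) (s s' : X) : HasLogOn (fun z => Φ s z / Φ s' z) K := by
  have hcs : ∀ s, ContinuousOn (Φ s) K := fun s =>
    hc.comp (f := fun z => (s, z)) (by fun_prop) fun z hz => ⟨trivial, hz⟩
  have := isCompact_iff_compactSpace.1 hK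
  refine PreconnectedSpace.induction₂' (fun s s' => HasLogOn (fun z => Φ s z / Φ s' z) K)
    (fun s => ?_) ⟨fun a b c hab hbc => ?_⟩ s s'
  · have hcont : Continuous fun w : X × K => Φ w.1 w.2 :=
      hc.comp_continuous (f := fun w : X × K => (w.1, (w.2 : Y))) (by fun_prop)
        fun w => ⟨trivial, w.2.2⟩
    have hev : ∀ᶠ t in nhds s, ∀ z ∈ (Set.univ : Set K), Φ s z / Φ t z ∈ Complex.slitPlane := by
      refine isCompact_univ.eventually_forall_of_forall_eventually (P := fun t (z : K) =>
        Φ s z / Φ t z ∈ Complex.slitPlane) fun z _ => ?_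
      have h1 : ContinuousAt (fun w : X × K => Φ s w.2 / Φ w.1 w.2) (s, z) :=
        ContinuousAt.div (hcont.comp (f := fun w : X × K => (s, w.2))
          (by fun_prop)).continuousAt hcont.continuousAt (h0 s z z.2)
      refine h1.eventually_mem (Complex.isOpen_slitPlane.mem_nhds ?_)
      simp [div_self (h0 s z z.2)]
    filter_upwards [hev] with t ht
    have : HasLogOn (fun z => Φ s z / Φ t z) K :=
      of_slitPlane ((hcs s).div (hcs t) (h0 t)) fun z hz => ht ⟨z, hz⟩ trivial
    exact ⟨this, this.inv.congr fun z _ => inv_div _ _⟩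
  · refine (hab.mul hbc).congr fun z hz => ?_
    field_simp [h0 b z hz]

lemma exists_int_of_exp_eq {a b : ℂ} (h : Complex.exp a = Complex.exp b) :
    ∃ n : ℤ, a = b + n * (2 * Real.pi * Complex.I) := Complex.exp_eq_exp_iff_exists_int.1 h

/-- Logarithms on two closed sets glue if they can be made to agree on the intersection. -/
lemma union (hK : IsClosed K) (hL : IsClosed L) {g h : Y → ℂ} (hg : ContinuousOn g K)
    (hh : ContinuousOn h L) (hge : ∀ z ∈ K, Complex.exp (g z) = f z)
    (hhe : ∀ z ∈ L, Complex.exp (h z) = f z) (n : ℤ)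
    (hn : ∀ z ∈ K ∩ L, g z = h z + n * (2 * Real.pi * Complex.I)) : HasLogOn f (K ∪ L) := by
  classical
  let k : Y → ℂ := fun z => if z ∈ K then g z else h z + n * (2 * Real.pi * Complex.I)
  have hkK : ∀ z ∈ K, k z = g z := fun z hz => if_pos hz
  have hkL : ∀ z ∈ L, k z = h z + n * (2 * Real.pi * Complex.I) := fun z hz => by
    by_cases hzK : z ∈ K
    · rw [hkK z hzK, hn z ⟨hzK, hz⟩]
    · exact if_neg hzK
  refine ⟨k, ((hg.congr hkK).union_of_isClosed ((hh.add continuousOn_const).congr hkL) hK hL), ?_⟩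
  rintro z (hz | hz)
  · rw [hkK z hz, hge z hz]
  · rw [hkL z hz, Complex.exp_add, Complex.exp_int_mul_two_pi_mul_I, mul_one, hhe z hz]

lemma union_singleton_inter (hK : IsClosed K) (hL : IsClosed L) (h : HasLogOn f K)
    (h' : HasLogOn f L) {m : Y} (hm : K ∩ L ⊆ {m}) : HasLogOn f (K ∪ L) := by
  obtain ⟨g, hg, hge⟩ := h
  obtain ⟨k, hk, hke⟩ := h'
  by_cases hmem : m ∈ K ∩ L
  · obtain ⟨n, hn⟩ := exists_int_of_exp_eq ((hge m hmem.1).trans (hke m hmem.2).symm)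
    exact union hK hL hg hk hge hke n fun z hz => by rw [hm hz]; exact hn
  · exact union hK hL hg hk hge hke 0 fun z hz => (hmem (hm hz ▸ hz)).elim

end HasLogOn

/-- Every nonvanishing continuous function on an arc has a continuous logarithm. -/
theorem hasLogOn_image_Icc {γ : ℝ → ℝ × ℝ} (hγ : ContinuousOn γ (Set.Icc 0 1))
    (hinj : Set.InjOn γ (Set.Icc 0 1)) {f : ℝ × ℝ → ℂ} (hf : ContinuousOn f (γ '' Set.Icc 0 1))
    (h0 : ∀ z ∈ γ '' Set.Icc 0 1, f z ≠ 0) : HasLogOn f (γ '' Set.Icc 0 1) := by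
  have hmem : ∀ s t : Set.Icc (0 : ℝ) 1, (s : ℝ) * t ∈ Set.Icc (0 : ℝ) 1 := fun s t =>
    ⟨mul_nonneg s.2.1 t.2.1, mul_le_one₀ s.2.2 t.2.1 t.2.2⟩
  have h1 : HasLogOn (fun t : Set.Icc (0 : ℝ) 1 => f (γ t)) Set.univ := by
    have := HasLogOn.div_of_preconnectedSpace (X := Set.Icc (0 : ℝ) 1) (Y := Set.Icc (0 : ℝ) 1)
      (K := Set.univ) isCompact_univ (Φ := fun s t => f (γ (s * t))) ?_
      (fun s t _ => h0 _ ⟨_, hmem s t, rfl⟩) 1 0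
    · refine (this.mul (HasLogOn.const (c := f (γ 0)) (h0 _ ⟨0, by simp, rfl⟩))).congr
        fun t _ => ?_
      have := h0 (γ 0) ⟨0, by simp, rfl⟩
      simp [this]
    · refine Continuous.continuousOn ?_
      refine hf.comp_continuous (f := fun w : Set.Icc (0 : ℝ) 1 × Set.Icc (0 : ℝ) 1 =>
        γ (w.1 * w.2)) ?_ fun w => ⟨_, hmem _ _, rfl⟩
      exact hγ.comp_continuous (f := fun w : Set.Icc (0 : ℝ) 1 × Set.Icc (0 : ℝ) 1 =>
        (w.1 : ℝ) * w.2) (by fun_prop) fun w => hmem _ _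
  obtain ⟨g, hg, he⟩ := h1
  have hemb : Topology.IsClosedEmbedding (fun t : Set.Icc (0 : ℝ) 1 => γ t) :=
    Continuous.isClosedEmbedding (continuousOn_iff_continuous_domRestrict.1 hγ)
      fun s t h => Subtype.ext (hinj s.2 t.2 h)
  obtain ⟨G, hG⟩ := ContinuousMap.exists_extension' hemb ⟨g, continuousOn_univ.1 hg⟩
  refine ⟨G, G.continuous.continuousOn, ?_⟩
  rintro _ ⟨t, ht, rfl⟩
  have h2 : G (γ t) = g ⟨t, ht⟩ := congrFun hG ⟨t, ht⟩
  rw [h2, he ⟨t, ht⟩ trivial]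

/-- A continuous complex function on the line whose exponential is constant is constant. -/
lemma eq_of_exp_eq {h : ℝ → ℂ} (hh : Continuous h)
    (he : ∀ t, Complex.exp (h t) = Complex.exp (h 0)) (t : ℝ) : h t = h 0 := by
  choose n hn using fun t => Complex.exp_eq_exp_iff_exists_int.1 (he t)
  have hcast : ∀ t, ((n t : ℝ)) = ((h t - h 0) / (2 * Real.pi * Complex.I)).re := fun t => by
    have : (h t - h 0) / (2 * Real.pi * Complex.I) = ((n t : ℝ) : ℂ) := by
      rw [div_eq_iff Complex.two_pi_I_ne_zero, hn t]; push_cast; ring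
    rw [this, Complex.ofReal_re]
  have hnc : Continuous n := by
    rw [Int.isClosedEmbedding_coe_real.isInducing.continuous_iff]
    have : ((↑) : ℤ → ℝ) ∘ n = fun t => ((h t - h 0) / (2 * Real.pi * Complex.I)).re :=
      funext hcast
    rw [this]
    fun_prop
  have h1 : n t = n 0 := PreconnectedSpace.constant inferInstance hnc
  have h2 := hn 0
  rw [hn t, h1, ← h2]

/-- A nonzero power has no continuous logarithm on the unit circle. -/
theorem eq_zero_of_hasLogOn_sphere {c : ℂ} {l : ℤ}
    (h : HasLogOn (fun u : ℂ => c * u ^ l) (Metric.sphere 0 1)) : l = 0 := by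
  obtain ⟨g, hg, he⟩ := h
  have hmem : ∀ t : ℝ, Complex.exp (t * Complex.I) ∈ Metric.sphere (0 : ℂ) 1 := fun t => by
    simp [Complex.norm_exp_ofReal_mul_I]
  have hcont : Continuous fun t : ℝ => g (Complex.exp (t * Complex.I)) - l * (t * Complex.I) :=
    (hg.comp_continuous (f := fun t : ℝ => Complex.exp (t * Complex.I)) (by fun_prop) hmem).sub
      (by fun_prop)
  have hexp : ∀ t : ℝ,
      Complex.exp (g (Complex.exp (t * Complex.I)) - l * (t * Complex.I)) = c := fun t => by
    rw [Complex.exp_sub, he _ (hmem t), Complex.exp_int_mul]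
    exact mul_div_cancel_right₀ _ (zpow_ne_zero _ (Complex.exp_ne_zero _))
  have := eq_of_exp_eq hcont (fun t => (hexp t).trans (hexp 0).symm) (2 * Real.pi)
  push_cast at this
  rw [Complex.exp_two_pi_mul_I] at this
  simp at this
  exact this

/-- The identification of the coordinate plane with the complex plane. -/
noncomputable def planeToComplex : ℝ × ℝ ≃ₜ ℂ := Complex.equivRealProdCLM.symm.toHomeomorph

section Separation

variable {K : Set (ℝ × ℝ)}

lemma isOpen_component (hK : IsClosed K) (p : ℝ × ℝ) : IsOpen (connectedComponentIn Kᶜ p) :=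
  hK.isOpen_compl.connectedComponentIn

lemma closure_component_subset (hK : IsClosed K) (p : ℝ × ℝ) :
    closure (connectedComponentIn Kᶜ p) ⊆ connectedComponentIn Kᶜ p ∪ K := by
  intro x hx
  by_cases hxK : x ∈ K
  · exact Or.inr hxK
  · obtain ⟨y, hy, hyp⟩ := mem_closure_iff.1 hx _ (isOpen_component hK x)
      (mem_connectedComponentIn hxK)
    rw [connectedComponentIn_eq hyp, ← connectedComponentIn_eq hy]
    exact Or.inl (mem_connectedComponentIn hxK)

/-- A function which is a product of powers of linear factors, one of whose zeros lies in a bounded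
component of the complement of `K` containing none of the other zeros, can have a continuous
logarithm on `K` only if the corresponding exponent vanishes. -/
theorem exponent_eq_zero (hK : IsCompact K) {p q r : ℝ × ℝ} (hp : p ∉ K) (hq : q ∉ K) (hr : r ∉ K)
    (hb : Bornology.IsBounded (connectedComponentIn Kᶜ p))
    (hqp : q ∉ connectedComponentIn Kᶜ p) (hrp : r ∉ connectedComponentIn Kᶜ p) {l m n : ℤ}
    (h : HasLogOn (fun z => (planeToComplex z - planeToComplex p) ^ l *
      ((planeToComplex z - planeToComplex q) ^ m * (planeToComplex z - planeToComplex r) ^ n)) K) :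
    l = 0 := by
  classical
  set U := connectedComponentIn Kᶜ p with hU
  have hUo : IsOpen U := isOpen_component hK.isClosed p
  have hpU : p ∈ U := mem_connectedComponentIn hp
  have hcl : closure U ⊆ U ∪ K := closure_component_subset hK.isClosed p
  have hne : ∀ {z w : ℝ × ℝ}, z ≠ w → planeToComplex z - planeToComplex w ≠ 0 := fun hzw =>
    sub_ne_zero.2 fun h => hzw (planeToComplex.injective h)
  have hnotcl : ∀ {w}, w ∉ K → w ∉ U → ∀ z ∈ closure U, z ≠ w := fun hwK hwU z hz hzw =>
    (hcl (hzw ▸ hz)).elim hwU hwK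
  obtain ⟨g, hg, he⟩ := h
  obtain ⟨G, hG⟩ := ContinuousMap.exists_restrict_eq hK.isClosed
    ⟨K.domRestrict g, continuousOn_iff_continuous_domRestrict.1 hg⟩
  have hGg : ∀ z ∈ K, G z = g z := fun z hz => congrArg (fun k => k ⟨z, hz⟩) hG
  let A : ℝ × ℝ → ℂ := fun z => Complex.exp (G z) *
    ((planeToComplex z - planeToComplex q) ^ (-m) * (planeToComplex z - planeToComplex r) ^ (-n))
  let B : ℝ × ℝ → ℂ := fun z => (planeToComplex z - planeToComplex p) ^ l
  let F : ℝ × ℝ → ℂ := fun z => if z ∈ U then A z else B z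
  have hzc : ∀ (w : ℝ × ℝ) (k : ℤ) (S : Set (ℝ × ℝ)), (∀ z ∈ S, z ≠ w) →
      ContinuousOn (fun z => (planeToComplex z - planeToComplex w) ^ k) S := fun w k S hS =>
    ContinuousOn.zpow₀ ((planeToComplex.continuous.sub continuous_const).continuousOn) k
      fun z hz => Or.inl (hne (hS z hz))
  have hF : Continuous F := by
    refine continuous_if ?_ ?_ ?_
    · intro z hz
      have hzU : z ∉ U := fun h => by
        have := frontier_subset_closure (s := Uᶜ) (by rwa [frontier_compl])
        rw [hUo.isClosed_compl.closure_eq] at this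
        exact this h
      have hzK : z ∈ K := (hcl (frontier_subset_closure hz)).resolve_left hzU
      have hzq : z ≠ q := fun h => hq (h ▸ hzK)
      have hzr : z ≠ r := fun h => hr (h ▸ hzK)
      simp only [A, B, hGg z hzK, he z hzK, zpow_neg]
      field_simp [zpow_ne_zero m (hne hzq), zpow_ne_zero n (hne hzr)]
    · exact (G.continuous.cexp.continuousOn).mul ((hzc q _ _ (hnotcl hq hqp)).mul
        (hzc r _ _ (hnotcl hr hrp)))
    · refine hzc p l _ fun z hz hzp => ?_
      have : z ∈ Uᶜ := by
        rw [← hUo.isClosed_compl.closure_eq]; exact hz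
      exact this (hzp ▸ hpU)
  have hF0 : ∀ z, F z ≠ 0 := fun z => by
    by_cases hz : z ∈ U
    · simp only [F, if_pos hz, A]
      refine mul_ne_zero (Complex.exp_ne_zero _) (mul_ne_zero (zpow_ne_zero _ (hne ?_))
        (zpow_ne_zero _ (hne ?_)))
      · rintro rfl; exact hqp hz
      · rintro rfl; exact hrp hz
    · simp only [F, if_neg hz, B]
      refine zpow_ne_zero _ (hne ?_)
      rintro rfl; exact hz hpU
  obtain ⟨R, hR⟩ : ∃ R : ℝ, ∀ z ∈ U, ‖planeToComplex z‖ ≤ R := by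
    have hcomp : IsCompact (planeToComplex '' closure U) :=
      hb.isCompact_closure.image planeToComplex.continuous
    obtain ⟨R, hR⟩ := hcomp.isBounded.exists_norm_le
    exact ⟨R, fun z hz => hR _ ⟨z, subset_closure hz, rfl⟩⟩
  set S : ℝ := |R| + ‖planeToComplex p‖ + 1 with hS
  have hSpos : 0 < S := by positivity
  have hout : ∀ u ∈ Metric.sphere (0 : ℂ) 1,
      planeToComplex.symm (planeToComplex p + S * u) ∉ U := fun u hu hmem => by
    have h1 := hR _ hmem
    rw [Homeomorph.apply_symm_apply] at h1
    have hu1 : ‖u‖ = 1 := by simpa using hu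
    have h2 : ‖(S : ℂ) * u‖ = S := by
      rw [norm_mul, hu1, mul_one, Complex.norm_real, Real.norm_of_nonneg hSpos.le]
    have h3 := norm_sub_le (planeToComplex p + S * u) (planeToComplex p)
    rw [add_sub_cancel_left, h2] at h3
    linarith [le_abs_self R]
  have hlog := HasLogOn.div_of_preconnectedSpace (X := ℝ) (isCompact_sphere (0 : ℂ) 1)
    (Φ := fun s u => F (planeToComplex.symm (planeToComplex p + s * S * u)))
    (Continuous.continuousOn (hF.comp (planeToComplex.symm.continuous.comp (by fun_prop))))
    (fun s u _ => hF0 _) 1 0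
  refine eq_zero_of_hasLogOn_sphere (c := (S : ℂ) ^ l / F p) (l := l) (hlog.congr fun u hu => ?_)
  have h4 : F (planeToComplex.symm (planeToComplex p + S * u)) = ((S : ℂ) * u) ^ l := by
    simp only [F, if_neg (hout u hu), B, Homeomorph.apply_symm_apply, add_sub_cancel_left]
  simp only [Complex.ofReal_one, one_mul, Complex.ofReal_zero, zero_mul, add_zero, h4,
    Homeomorph.symm_apply_apply, mul_zpow]
  ring

/-- A compact set has at most one unbounded complementary component. -/
theorem component_eq_of_unbounded (hK : IsCompact K) {p q : ℝ × ℝ}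
    (hp : ¬ Bornology.IsBounded (connectedComponentIn Kᶜ p))
    (hq : ¬ Bornology.IsBounded (connectedComponentIn Kᶜ q)) :
    connectedComponentIn Kᶜ p = connectedComponentIn Kᶜ q := by
  obtain ⟨R, hR⟩ := (hK.image planeToComplex.continuous).isBounded.exists_norm_le
  set S : Set (ℝ × ℝ) := {z | |R| < ‖planeToComplex z‖} with hS
  have hpre : IsPreconnected S := by
    have h1 : IsPreconnected ((fun w : ℝ × ℝ => planeToComplex.symm
        (w.1 * Complex.exp (w.2 * Complex.I))) '' (Set.Ioi |R| ×ˢ Set.univ)) :=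
      (isPreconnected_Ioi.prod isPreconnected_univ).image _
        (planeToComplex.symm.continuous.comp (by fun_prop)).continuousOn
    convert h1
    ext z
    constructor
    · intro hz
      refine ⟨(‖planeToComplex z‖, Complex.arg (planeToComplex z)), ⟨hz, trivial⟩, ?_⟩
      simp [Complex.norm_mul_exp_arg_mul_I]
    · rintro ⟨w, ⟨hw, -⟩, rfl⟩
      have hw0 : 0 ≤ w.1 := (abs_nonneg R).trans (le_of_lt hw)
      simpa [hS, Complex.norm_exp_ofReal_mul_I, abs_of_nonneg hw0] using hw
  have hSK : S ⊆ Kᶜ := fun z hz hzK => by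
    have := hR _ ⟨z, hzK, rfl⟩
    exact absurd (lt_of_lt_of_le hz this) (not_lt.2 (le_abs_self R))
  have hmeet : ∀ {p}, ¬ Bornology.IsBounded (connectedComponentIn Kᶜ p) →
      ∃ z ∈ connectedComponentIn Kᶜ p, z ∈ S := fun {p} hp => by
    by_contra! hcon
    refine hp (Bornology.IsBounded.subset
      ((isCompact_closedBall (0 : ℂ) |R|).image planeToComplex.symm.continuous).isBounded
      fun z hz => ⟨planeToComplex z, ?_, by simp⟩)
    have : ¬ |R| < ‖planeToComplex z‖ := hcon z hz
    simpa using this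
  obtain ⟨z, hz, hzS⟩ := hmeet hp
  obtain ⟨w, hw, hwS⟩ := hmeet hq
  rw [connectedComponentIn_eq hz, connectedComponentIn_eq hw]
  exact connectedComponentIn_eq (hpre.subset_connectedComponentIn hzS hSK hwS)

/-- The quotient of two linear factors with zeros in a connected set disjoint from the compact set
`K` has a continuous logarithm on `K`. -/
lemma hasLogOn_quotient (hK : IsCompact K) {S : Set (ℝ × ℝ)} (hS : IsPreconnected S)
    (hSK : S ⊆ Kᶜ) {p q : ℝ × ℝ} (hp : p ∈ S) (hq : q ∈ S) :
    HasLogOn (fun z => (planeToComplex z - planeToComplex p) /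
      (planeToComplex z - planeToComplex q)) K := by
  have : PreconnectedSpace S := Subtype.preconnectedSpace hS
  have h := HasLogOn.div_of_preconnectedSpace (X := S) hK
    (Φ := fun s z => planeToComplex z - planeToComplex s) ?_ ?_ ⟨p, hp⟩ ⟨q, hq⟩
  · exact h
  · exact ((planeToComplex.continuous.comp continuous_snd).sub (planeToComplex.continuous.comp
      (continuous_subtype_val.comp continuous_fst))).continuousOn
  · exact fun s z hz => sub_ne_zero.2 fun h => hSK s.2 (planeToComplex.injective h ▸ hz)

/-- If a compact set is the union of a compact set `K` and a compact set `A` on which continuous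
nonvanishing functions have continuous logarithms, and `K` and `A` share at most two points, then
no point off `K` is in the closure of three different complementary components of the union. -/
theorem not_three_components {A : Set (ℝ × ℝ)} (hK : IsCompact K) (hA : IsCompact A)
    (hlog : ∀ f : ℝ × ℝ → ℂ, ContinuousOn f A → (∀ z ∈ A, f z ≠ 0) → HasLogOn f A)
    {a b m : ℝ × ℝ} (hab : K ∩ A ⊆ {a, b}) (hm : m ∉ K) {p q r : ℝ × ℝ}
    (hp : p ∉ K ∪ A) (hq : q ∉ K ∪ A) (hr : r ∉ K ∪ A)
    (hmp : m ∈ closure (connectedComponentIn (K ∪ A)ᶜ p))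
    (hmq : m ∈ closure (connectedComponentIn (K ∪ A)ᶜ q))
    (hmr : m ∈ closure (connectedComponentIn (K ∪ A)ᶜ r))
    (hpq : connectedComponentIn (K ∪ A)ᶜ p ≠ connectedComponentIn (K ∪ A)ᶜ q)
    (hpr : connectedComponentIn (K ∪ A)ᶜ p ≠ connectedComponentIn (K ∪ A)ᶜ r)
    (hqr : connectedComponentIn (K ∪ A)ᶜ q ≠ connectedComponentIn (K ∪ A)ᶜ r) : False := by
  classical
  have hKA : IsCompact (K ∪ A) := hK.union hA
  have hsame : ∀ {p}, p ∉ K ∪ A → m ∈ closure (connectedComponentIn (K ∪ A)ᶜ p) →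
      p ∈ connectedComponentIn Kᶜ m := by
    intro p hp hmp
    obtain ⟨z, hz, hzp⟩ := mem_closure_iff.1 hmp _ (isOpen_component hK.isClosed m)
      (mem_connectedComponentIn hm)
    rw [connectedComponentIn_eq hz]
    refine isPreconnected_connectedComponentIn.subset_connectedComponentIn hzp
      ((connectedComponentIn_subset _ _).trans (Set.compl_subset_compl.2 Set.subset_union_left))
      (mem_connectedComponentIn hp)
  have hne : ∀ {w z : ℝ × ℝ}, w ∉ K ∪ A → z ∈ K ∪ A → planeToComplex z - planeToComplex w ≠ 0 :=
    fun hw hz => sub_ne_zero.2 fun h => hw (planeToComplex.injective h ▸ hz)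
  have hjump : ∀ {w}, w ∉ K ∪ A → m ∈ closure (connectedComponentIn (K ∪ A)ᶜ w) →
      ∃ (g h : ℝ × ℝ → ℂ) (i j : ℤ), ContinuousOn g K ∧ ContinuousOn h A ∧
        (∀ z ∈ K, Complex.exp (g z) = (planeToComplex z - planeToComplex p) /
          (planeToComplex z - planeToComplex w)) ∧
        (∀ z ∈ A, Complex.exp (h z) = (planeToComplex z - planeToComplex p) /
          (planeToComplex z - planeToComplex w)) ∧
        (a ∈ K ∩ A → g a = h a + i * (2 * Real.pi * Complex.I)) ∧
        (b ∈ K ∩ A → g b = h b + j * (2 * Real.pi * Complex.I)) := by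
    intro w hw hmw
    obtain ⟨g, hg, hge⟩ := hasLogOn_quotient hK isPreconnected_connectedComponentIn
      (connectedComponentIn_subset _ _) (hsame hp hmp) (hsame hw hmw)
    obtain ⟨h, hh, hhe⟩ := hlog (fun z => (planeToComplex z - planeToComplex p) /
      (planeToComplex z - planeToComplex w))
      ((planeToComplex.continuous.sub continuous_const).continuousOn.div
        (planeToComplex.continuous.sub continuous_const).continuousOn
        fun z hz => hne hw (Or.inr hz))
      fun z hz => div_ne_zero (hne hp (Or.inr hz)) (hne hw (Or.inr hz))
    have hint : ∀ c, ∃ i : ℤ, c ∈ K ∩ A → g c = h c + i * (2 * Real.pi * Complex.I) := fun c => by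
      by_cases hc : c ∈ K ∩ A
      · obtain ⟨i, hi⟩ := HasLogOn.exists_int_of_exp_eq ((hge c hc.1).trans (hhe c hc.2).symm)
        exact ⟨i, fun _ => hi⟩
      · exact ⟨0, fun h => (hc h).elim⟩
    obtain ⟨i, hi⟩ := hint a
    obtain ⟨j, hj⟩ := hint b
    exact ⟨g, h, i, j, hg, hh, hge, hhe, hi, hj⟩
  obtain ⟨g, h, i, j, hg, hh, hge, hhe, hi, hj⟩ := hjump hq hmq
  obtain ⟨g', h', i', j', hg', hh', hge', hhe', hi', hj'⟩ := hjump hr hmr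
  obtain ⟨s, t, hst, hne0⟩ : ∃ s t : ℤ, s * (i - j) + t * (i' - j') = 0 ∧ ¬ (s = 0 ∧ t = 0) := by
    by_cases h0 : i - j = 0
    · exact ⟨1, 0, by simp [h0], by simp⟩
    · exact ⟨i' - j', -(i - j), by ring, fun h => h0 (by lia)⟩
  have hunion : HasLogOn (fun z => ((planeToComplex z - planeToComplex p) /
      (planeToComplex z - planeToComplex q)) ^ s * ((planeToComplex z - planeToComplex p) /
      (planeToComplex z - planeToComplex r)) ^ t) (K ∪ A) := by
    refine HasLogOn.union hK.isClosed hA.isClosed (g := fun z => s * g z + t * g' z)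
      (h := fun z => s * h z + t * h' z)
      ((continuousOn_const.mul hg).add (continuousOn_const.mul hg'))
      ((continuousOn_const.mul hh).add (continuousOn_const.mul hh')) ?_ ?_ (s * i + t * i') ?_
    · intro z hz
      rw [Complex.exp_add, Complex.exp_int_mul, Complex.exp_int_mul, hge z hz, hge' z hz]
    · intro z hz
      rw [Complex.exp_add, Complex.exp_int_mul, Complex.exp_int_mul, hhe z hz, hhe' z hz]
    · intro z hz
      rcases hab hz with rfl | rfl
      · simp only [hi hz, hi' hz]; push_cast; ring
      · have hst' : (s : ℂ) * (i - j) + t * (i' - j') = 0 := by exact_mod_cast hst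
        simp only [hj hz, hj' hz]; push_cast
        linear_combination (-(2 * Real.pi * Complex.I)) * hst'
  have hprod : HasLogOn (fun z => (planeToComplex z - planeToComplex p) ^ (s + t) *
      ((planeToComplex z - planeToComplex q) ^ (-s) *
        (planeToComplex z - planeToComplex r) ^ (-t))) (K ∪ A) := hunion.congr fun z hz => by
    rw [zpow_add₀ (hne hp hz), div_zpow, div_zpow, zpow_neg, zpow_neg]
    ring
  have hout : ∀ {u v}, u ∉ K ∪ A →
      connectedComponentIn (K ∪ A)ᶜ v ≠ connectedComponentIn (K ∪ A)ᶜ u →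
      u ∉ connectedComponentIn (K ∪ A)ᶜ v := fun _ hne h => hne (connectedComponentIn_eq h)
  have bp : Bornology.IsBounded (connectedComponentIn (K ∪ A)ᶜ p) → s + t = 0 := fun hb =>
    exponent_eq_zero hKA hp hq hr hb (hout hq hpq) (hout hr hpr) hprod
  have bq : Bornology.IsBounded (connectedComponentIn (K ∪ A)ᶜ q) → -s = 0 := fun hb =>
    exponent_eq_zero hKA hq hp hr hb (hout hp hpq.symm) (hout hr hqr)
      (hprod.congr fun z _ => by ring)
  have br : Bornology.IsBounded (connectedComponentIn (K ∪ A)ᶜ r) → -t = 0 := fun hb =>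
    exponent_eq_zero hKA hr hp hq hb (hout hp hpr.symm) (hout hq hqr.symm)
      (hprod.congr fun z _ => by ring)
  by_cases hbp : Bornology.IsBounded (connectedComponentIn (K ∪ A)ᶜ p)
  · have h1 := bp hbp
    by_cases hbq : Bornology.IsBounded (connectedComponentIn (K ∪ A)ᶜ q)
    · have h2 := bq hbq
      exact hne0 ⟨by lia, by lia⟩
    · by_cases hbr : Bornology.IsBounded (connectedComponentIn (K ∪ A)ᶜ r)
      · have h2 := br hbr
        exact hne0 ⟨by lia, by lia⟩
      · exact hqr (component_eq_of_unbounded hKA hbq hbr)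
  · by_cases hbq : Bornology.IsBounded (connectedComponentIn (K ∪ A)ᶜ q)
    · by_cases hbr : Bornology.IsBounded (connectedComponentIn (K ∪ A)ᶜ r)
      · have h1 := bq hbq
        have h2 := br hbr
        exact hne0 ⟨by lia, by lia⟩
      · exact hpr (component_eq_of_unbounded hKA hbp hbr)
    · exact hpq (component_eq_of_unbounded hKA hbp hbq)

end Separation

section Embedding

variable {V : Type} {G : SimpleGraph V} {vtx : V → ℝ × ℝ} {arc : V → V → ℝ → ℝ × ℝ}

lemma IsPlaneEmbedding.arcImage_comm (hemb : IsPlaneEmbedding G vtx arc) {u v : V}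
    (h : G.Adj u v) : ArcImage (arc v u) = ArcImage (arc u v) := by
  ext p
  constructor
  · rintro ⟨t, ht, rfl⟩
    exact ⟨1 - t, ⟨by linarith [ht.2], by linarith [ht.1]⟩, (hemb.arc_symm h t).symm⟩
  · rintro ⟨t, ht, rfl⟩
    exact ⟨1 - t, ⟨by linarith [ht.2], by linarith [ht.1]⟩, (hemb.arc_symm h.symm t).symm⟩

lemma IsPlaneEmbedding.eq_or_mem_arcInterior (hemb : IsPlaneEmbedding G vtx arc) {u v : V}
    (h : G.Adj u v) {p : ℝ × ℝ} (hp : p ∈ ArcImage (arc u v)) :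
    p = vtx u ∨ p = vtx v ∨ p ∈ ArcInterior (arc u v) := by
  obtain ⟨t, ht, rfl⟩ := hp
  rcases eq_or_lt_of_le ht.1 with rfl | h0
  · exact Or.inl (hemb.arc_start h)
  · rcases eq_or_lt_of_le ht.2 with rfl | h1
    · exact Or.inr (Or.inl (hemb.arc_end h))
    · exact Or.inr (Or.inr ⟨t, ⟨h0, h1⟩, rfl⟩)

lemma IsPlaneEmbedding.left_mem_arcImage (hemb : IsPlaneEmbedding G vtx arc) {u v : V}
    (h : G.Adj u v) : vtx u ∈ ArcImage (arc u v) :=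
  ⟨0, by simp, hemb.arc_start h⟩

lemma IsPlaneEmbedding.isCompact_arcImage (hemb : IsPlaneEmbedding G vtx arc) {u v : V}
    (h : G.Adj u v) : IsCompact (ArcImage (arc u v)) :=
  isCompact_Icc.image_of_continuousOn (hemb.arc_cont h)

lemma IsPlaneEmbedding.vtx_notMem_arcImage (hemb : IsPlaneEmbedding G vtx arc) {u v y : V}
    (h : G.Adj u v) (hu : u ≠ y) (hv : v ≠ y) : vtx y ∉ ArcImage (arc u v) := fun hy => by
  rcases hemb.eq_or_mem_arcInterior h hy with h' | h' | h'
  · exact hu (hemb.vtx_inj h').symm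
  · exact hv (hemb.vtx_inj h').symm
  · exact hemb.arc_avoids_vtx h y h'

/-- Two distinct edges meet at most in endpoints. -/
lemma IsPlaneEmbedding.eq_of_mem_arcImage (hemb : IsPlaneEmbedding G vtx arc) {u v u' v' : V}
    (h : G.Adj u v) (h' : G.Adj u' v') (hne : s(u, v) ≠ s(u', v')) {p : ℝ × ℝ}
    (hp : p ∈ ArcImage (arc u v)) (hp' : p ∈ ArcImage (arc u' v')) :
    (p = vtx u ∨ p = vtx v) ∧ (p = vtx u' ∨ p = vtx v') := by
  have hd := hemb.arc_disjoint h h' hne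
  rcases hemb.eq_or_mem_arcInterior h hp with h1 | h1 | h1 <;>
  rcases hemb.eq_or_mem_arcInterior h' hp' with h2 | h2 | h2
  · exact ⟨Or.inl h1, Or.inl h2⟩
  · exact ⟨Or.inl h1, Or.inr h2⟩
  · exact (hemb.arc_avoids_vtx h' u (h1 ▸ h2)).elim
  · exact ⟨Or.inr h1, Or.inl h2⟩
  · exact ⟨Or.inr h1, Or.inr h2⟩
  · exact (hemb.arc_avoids_vtx h' v (h1 ▸ h2)).elim
  · exact (hemb.arc_avoids_vtx h u' (h2 ▸ h1)).elim
  · exact (hemb.arc_avoids_vtx h v' (h2 ▸ h1)).elim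
  · exact ((hd ▸ Set.mem_inter h1 h2 : p ∈ (∅ : Set (ℝ × ℝ)))).elim

lemma vtx_mem_walkDrawing (hemb : IsPlaneEmbedding G vtx arc) {a u v : V} {w : G.Walk a a}
    (h : s(u, v) ∈ w.edges) : vtx u ∈ WalkDrawing G arc w := by
  have huv : G.Adj u v := w.adj_of_mem_edges h
  simp only [WalkDrawing, Set.mem_iUnion]
  exact ⟨u, v, huv, h, hemb.left_mem_arcImage huv⟩

/-- The part of a drawing that avoids the vertex `y`. -/
def DrawingAvoiding (G : SimpleGraph V) (vtx : V → ℝ × ℝ) (arc : V → V → ℝ → ℝ × ℝ) (y : V) :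
    Set (ℝ × ℝ) :=
  vtx '' {y}ᶜ ∪ ⋃ (u : V) (v : V) (_ : G.Adj u v ∧ u ≠ y ∧ v ≠ y), ArcImage (arc u v)

lemma IsPlaneEmbedding.isCompact_drawingAvoiding [Finite V] (hemb : IsPlaneEmbedding G vtx arc)
    (y : V) : IsCompact (DrawingAvoiding G vtx arc y) :=
  (Set.toFinite _).isCompact.union <| isCompact_iUnion fun _ => isCompact_iUnion fun _ =>
    isCompact_iUnion fun h => hemb.isCompact_arcImage h.1

lemma IsPlaneEmbedding.vtx_notMem_drawingAvoiding (hemb : IsPlaneEmbedding G vtx arc) (y : V) :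
    vtx y ∉ DrawingAvoiding G vtx arc y := by
  rintro (⟨u, hu, h⟩ | h)
  · exact hu (hemb.vtx_inj h)
  · simp only [Set.mem_iUnion] at h
    obtain ⟨u, v, h, hy⟩ := h
    exact hemb.vtx_notMem_arcImage h.1 h.2.1 h.2.2 hy

lemma IsPlaneEmbedding.drawingAvoiding_inter (hemb : IsPlaneEmbedding G vtx arc) {x y : V}
    (h : G.Adj x y) : DrawingAvoiding G vtx arc y ∩ ArcImage (arc x y) ⊆ {vtx x} := by
  rintro p ⟨hp, hpA⟩
  have hpy : p ≠ vtx y := fun h => hemb.vtx_notMem_drawingAvoiding y (h ▸ hp)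
  rcases hp with ⟨u, hu, rfl⟩ | hp
  · by_contra hux
    exact hemb.vtx_notMem_arcImage h (fun h => hux (by simp [h]))
      (fun h => hu h.symm) hpA
  · simp only [Set.mem_iUnion] at hp
    obtain ⟨u, v, ⟨huv, hu, hv⟩, hp⟩ := hp
    have hne : s(x, y) ≠ s(u, v) := by
      rw [Ne, Sym2.eq_iff]
      rintro (⟨-, rfl⟩ | ⟨-, rfl⟩) <;> contradiction
    exact (hemb.eq_of_mem_arcImage h huv hne hpA hp).1.resolve_right hpy

/-- A face bounded by a walk is a complementary component of every subset of the drawing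
containing that walk. -/
lemma FaceBoundedBy.eq_component {f : Set (ℝ × ℝ)} {a : V} {w : G.Walk a a}
    (hf : FaceBoundedBy G vtx arc f w) {K : Set (ℝ × ℝ)}
    (hwK : WalkDrawing G arc w ⊆ K) (hKD : K ⊆ Drawing G vtx arc) :
    ∃ p ∉ K, f = connectedComponentIn Kᶜ p := by
  obtain ⟨⟨p, hp, hfp⟩, hfr⟩ := hf
  have hpK : p ∉ K := fun h => hp (hKD h)
  have hpf : p ∈ f := hfp ▸ mem_connectedComponentIn hp
  refine ⟨p, hpK, Set.Subset.antisymm ?_ ?_⟩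
  · rw [hfp]
    exact connectedComponentIn_mono p (Set.compl_subset_compl.2 hKD)
  · have hfK : f ⊆ Kᶜ := hfp ▸ (connectedComponentIn_subset _ _).trans
      (Set.compl_subset_compl.2 hKD)
    have hcl : closure f ⊆ f ∪ K := by
      rw [closure_eq_self_union_frontier, hfr]
      exact Set.union_subset_union_right _ hwK
    have hint : frontier f ⊆ K := hfr ▸ hwK
    intro z hz
    by_contra hzf
    have hpre := isPreconnected_connectedComponentIn (F := Kᶜ) (x := p)
    have hsub := connectedComponentIn_subset Kᶜ p
    have hcover : connectedComponentIn Kᶜ p ⊆ interior f ∪ (closure f)ᶜ := fun t ht => by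
      by_cases htf : t ∈ closure f
      · by_cases hti : t ∈ interior f
        · exact Or.inl hti
        · exact (hsub ht (hint ⟨htf, hti⟩)).elim
      · exact Or.inr htf
    have hpi : p ∈ interior f := by
      by_contra hpi
      exact hpK (hint ⟨subset_closure hpf, hpi⟩)
    obtain ⟨t, -, htu, htv⟩ := hpre (interior f) (closure f)ᶜ isOpen_interior
      isClosed_closure.isOpen_compl hcover ⟨p, mem_connectedComponentIn hpK, hpi⟩
      ⟨z, hz, fun h => (hcl h).elim hzf (hsub hz)⟩
    exact htv (interior_subset_closure htu)

lemma IsCycle.eq_or_eq_of_edge_mem {a x y z t : V} {w : G.Walk a a} (hw : w.IsCycle)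
    (hxz : x ≠ z) (hx : s(x, y) ∈ w.edges) (hz : s(y, z) ∈ w.edges) (ht : s(y, t) ∈ w.edges) :
    t = x ∨ t = z := by
  have hcard := hw.ncard_neighborSet_toSubgraph_eq_two (w.fst_mem_support_of_mem_edges hz)
  obtain ⟨c, d, -, hcd⟩ := Set.ncard_eq_two.1 hcard
  have hmem : ∀ v, s(y, v) ∈ w.edges → v = c ∨ v = d := fun v hv => by
    have : v ∈ w.toSubgraph.neighborSet y := by
      rwa [Subgraph.mem_neighborSet, Walk.adj_toSubgraph_iff_mem_edges]
    simpa [hcd] using this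
  have h1 := hmem x (by rwa [Sym2.eq_swap])
  have h2 := hmem z hz
  have h3 := hmem t ht
  grind

section Corner

variable [Finite V] (hemb : IsPlaneEmbedding G vtx arc) {x y z a b : V} (hxz : x ≠ z)
  {w₁ : G.Walk a a} {w₂ : G.Walk b b} {f₁ f₂ : Set (ℝ × ℝ)} (hw₁ : w₁.IsCycle) (hw₂ : w₂.IsCycle)
  (hf₁ : FaceBoundedBy G vtx arc f₁ w₁) (hf₂ : FaceBoundedBy G vtx arc f₂ w₂) (hne : f₁ ≠ f₂)
  (hx₁ : s(x, y) ∈ w₁.edges) (hz₁ : s(y, z) ∈ w₁.edges)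
  (hx₂ : s(x, y) ∈ w₂.edges) (hz₂ : s(y, z) ∈ w₂.edges)

include hemb hxz hw₁ hw₂ hf₁ hf₂ hne hx₁ hz₁ hx₂ hz₂

/-- If two faces share two consecutive edges `xy` and `yz`, no further connected set
off these edges and off the part of the drawing avoiding `y` accumulates at `y`. -/
theorem not_mem_closure_of_shared_corner {S : Set (ℝ × ℝ)} (hS : IsPreconnected S)
    (hSK : S ⊆ (DrawingAvoiding G vtx arc y ∪ (ArcImage (arc x y) ∪ ArcImage (arc y z)))ᶜ)
    (hS₁ : Disjoint S f₁) (hS₂ : Disjoint S f₂) : vtx y ∉ closure S := by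
  intro hyS
  have hxy : G.Adj x y := w₁.adj_of_mem_edges hx₁
  have hyz : G.Adj y z := w₁.adj_of_mem_edges hz₁
  set K := DrawingAvoiding G vtx arc y with hKdef
  set A := ArcImage (arc x y) ∪ ArcImage (arc y z) with hAdef
  have hK : IsCompact K := hemb.isCompact_drawingAvoiding y
  have hA₁ := hemb.isCompact_arcImage hxy
  have hA₂ := hemb.isCompact_arcImage hyz
  have hA : IsCompact A := hA₁.union hA₂
  have hKD : K ∪ A ⊆ Drawing G vtx arc := by
    have harc : ∀ {u v}, G.Adj u v → ArcImage (arc u v) ⊆ Drawing G vtx arc := fun {u v} h p hp => by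
      refine Or.inr ?_
      simp only [Set.mem_iUnion]
      exact ⟨u, v, h, hp⟩
    refine Set.union_subset (Set.union_subset ?_ ?_) (Set.union_subset (harc hxy) (harc hyz))
    · rintro _ ⟨u, -, rfl⟩
      exact Or.inl ⟨u, rfl⟩
    · simp only [Set.iUnion_subset_iff]
      exact fun u v h => harc h.1
  have hW : ∀ {c : V} {w : G.Walk c c}, w.IsCycle → s(x, y) ∈ w.edges → s(y, z) ∈ w.edges →
      WalkDrawing G arc w ⊆ K ∪ A := by
    intro c w hw hx hz
    simp only [WalkDrawing, Set.iUnion_subset_iff]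
    intro u v huv he
    have hstar : ∀ {t}, G.Adj y t → s(y, t) ∈ w.edges → ArcImage (arc y t) ⊆ K ∪ A := by
      intro t hyt ht
      rcases IsCycle.eq_or_eq_of_edge_mem hw hxz hx hz ht with rfl | rfl
      · rw [hemb.arcImage_comm hyt.symm]
        exact fun p hp => Or.inr (Or.inl hp)
      · exact fun p hp => Or.inr (Or.inr hp)
    by_cases hu : u = y
    · subst hu; exact hstar huv he
    · by_cases hv : v = y
      · subst hv
        rw [← hemb.arcImage_comm huv]
        exact hstar huv.symm (by rwa [Sym2.eq_swap])
      · intro p hp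
        refine Or.inl (Or.inr ?_)
        simp only [Set.mem_iUnion]
        exact ⟨u, v, ⟨huv, hu, hv⟩, hp⟩
  obtain ⟨p, hp, hfp⟩ := hf₁.eq_component (hW hw₁ hx₁ hz₁) hKD
  obtain ⟨q, hq, hfq⟩ := hf₂.eq_component (hW hw₂ hx₂ hz₂) hKD
  obtain ⟨r, hr⟩ : S.Nonempty := closure_nonempty_iff.1 ⟨_, hyS⟩
  have hSr : S ⊆ connectedComponentIn (K ∪ A)ᶜ r := hS.subset_connectedComponentIn hr hSK
  have hyf : ∀ {c : V} {w : G.Walk c c} {f}, FaceBoundedBy G vtx arc f w → s(y, z) ∈ w.edges →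
      vtx y ∈ closure f := fun hf hz =>
    frontier_subset_closure (hf.2 ▸ vtx_mem_walkDrawing hemb hz)
  have hrne : ∀ {f p}, f = connectedComponentIn (K ∪ A)ᶜ p → Disjoint S f →
      connectedComponentIn (K ∪ A)ᶜ p ≠ connectedComponentIn (K ∪ A)ᶜ r := fun hf hd h =>
    Set.disjoint_left.1 hd hr (by rw [hf, h]; exact mem_connectedComponentIn (hSK hr))
  refine not_three_components (a := vtx x) (b := vtx z) (m := vtx y) hK hA ?_ ?_
    (hemb.vtx_notMem_drawingAvoiding y) hp hq (hSK hr) (hfp ▸ hyf hf₁ hz₁) (hfq ▸ hyf hf₂ hz₂)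
    (closure_mono hSr hyS) (hfp ▸ hfq ▸ hne) (hrne hfp hS₁) (hrne hfq hS₂)
  · intro g hg hg0
    refine HasLogOn.union_singleton_inter hA₁.isClosed hA₂.isClosed (m := vtx y)
      (hasLogOn_image_Icc (hemb.arc_cont hxy) (hemb.arc_injOn hxy)
        (hg.mono Set.subset_union_left) fun p hp => hg0 p (Or.inl hp))
      (hasLogOn_image_Icc (hemb.arc_cont hyz) (hemb.arc_injOn hyz)
        (hg.mono Set.subset_union_right) fun p hp => hg0 p (Or.inr hp)) ?_
    rintro p ⟨h1, h2⟩
    have hne' : s(x, y) ≠ s(y, z) := by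
      rw [Ne, Sym2.eq_iff]
      rintro (⟨h, -⟩ | ⟨h, -⟩)
      · exact hxy.ne h
      · exact hxz h
    obtain ⟨h3 | h3, h4 | h4⟩ := hemb.eq_of_mem_arcImage hxy hyz hne' h1 h2
    · exact h4
    · exact (hxz (hemb.vtx_inj (h3.symm.trans h4))).elim
    · exact h3
    · exact h3
  · rintro p ⟨hpK, hpA | hpA⟩
    · exact Or.inl (hemb.drawingAvoiding_inter hxy ⟨hpK, hpA⟩)
    · exact Or.inr (hemb.drawingAvoiding_inter hyz.symm ⟨hpK, by rwa [hemb.arcImage_comm hyz]⟩)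

/-- The middle vertex of two consecutive edges shared by two faces has degree two. -/
theorem eq_or_eq_of_shared_corner {t : V} (hyt : G.Adj y t) : t = x ∨ t = z := by
  by_contra! hcon
  have hxy : G.Adj x y := w₁.adj_of_mem_edges hx₁
  have hyz : G.Adj y z := w₁.adj_of_mem_edges hz₁
  have hdisj : ∀ {c : V} {w : G.Walk c c} {f}, FaceBoundedBy G vtx arc f w →
      Disjoint (ArcInterior (arc y t)) f := by
    rintro c w f ⟨⟨p, -, rfl⟩, -⟩
    refine Set.disjoint_left.2 fun q hq hqf => connectedComponentIn_subset _ _ hqf ?_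
    refine Or.inr ?_
    simp only [Set.mem_iUnion]
    exact ⟨y, t, hyt, Set.image_mono Set.Ioo_subset_Icc_self hq⟩
  have hnot : ∀ {u v}, G.Adj u v → s(u, v) ≠ s(y, t) → ∀ p ∈ ArcInterior (arc y t),
      p ∉ ArcImage (arc u v) := fun {u v} huv hne p hp hp' => by
    rcases (hemb.eq_of_mem_arcImage huv hyt hne hp'
      (Set.image_mono Set.Ioo_subset_Icc_self hp)).1 with rfl | rfl <;>
    exact hemb.arc_avoids_vtx hyt _ hp
  refine not_mem_closure_of_shared_corner hemb hxz hw₁ hw₂ hf₁ hf₂ hne hx₁ hz₁ hx₂ hz₂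
    (S := ArcInterior (arc y t))
    (isPreconnected_Ioo.image _ ((hemb.arc_cont hyt).mono Set.Ioo_subset_Icc_self)) ?_
    (hdisj hf₁) (hdisj hf₂) ?_
  · rintro p hp ((⟨u, -, rfl⟩ | hpK) | hpA | hpA)
    · exact hemb.arc_avoids_vtx hyt _ hp
    · simp only [Set.mem_iUnion] at hpK
      obtain ⟨u, v, ⟨huv, hu, hv⟩, hpK⟩ := hpK
      refine hnot huv ?_ p hp hpK
      rw [Ne, Sym2.eq_iff]
      rintro (⟨rfl, -⟩ | ⟨-, rfl⟩) <;> contradiction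
    · refine hnot hxy ?_ p hp hpA
      rw [Ne, Sym2.eq_iff]
      rintro (⟨rfl, -⟩ | ⟨rfl, -⟩)
      · exact hxy.ne rfl
      · exact hcon.1 rfl
    · refine hnot hyz ?_ p hp hpA
      rw [Ne, Sym2.eq_iff]
      rintro (⟨-, rfl⟩ | ⟨-, rfl⟩)
      · exact hcon.2 rfl
      · exact hyz.ne rfl
  · have h1 : closure (Set.Ioo (0 : ℝ) 1) = Set.Icc 0 1 := closure_Ioo (by norm_num)
    have h2 : (0 : ℝ) ∈ closure (Set.Ioo (0 : ℝ) 1) := by rw [h1]; simp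
    rw [← hemb.arc_start hyt]
    exact ((hemb.arc_cont hyt 0 (by simp)).mono Set.Ioo_subset_Icc_self).mem_closure_image h2

/-- The middle vertex of two consecutive edges shared by two faces is on no third face. -/
theorem notMem_frontier_of_shared_corner {f : Set (ℝ × ℝ)} (hf : IsFace G vtx arc f)
    (h₁ : f₁ ≠ f) (h₂ : f₂ ≠ f) : vtx y ∉ frontier f := by
  have hxy : G.Adj x y := w₁.adj_of_mem_edges hx₁
  have hyz : G.Adj y z := w₁.adj_of_mem_edges hz₁
  obtain ⟨p, hp, rfl⟩ := hf
  have hdisj : ∀ {c : V} {w : G.Walk c c} {f'}, FaceBoundedBy G vtx arc f' w →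
      f' ≠ connectedComponentIn (Drawing G vtx arc)ᶜ p →
      Disjoint (connectedComponentIn (Drawing G vtx arc)ᶜ p) f' := by
    rintro c w f' ⟨⟨q, -, rfl⟩, -⟩ hne'
    refine Set.disjoint_left.2 fun r hr hr' => hne' ?_
    rw [connectedComponentIn_eq hr, connectedComponentIn_eq hr']
  refine fun h => not_mem_closure_of_shared_corner hemb hxz hw₁ hw₂ hf₁ hf₂ hne hx₁ hz₁ hx₂ hz₂
    isPreconnected_connectedComponentIn ?_ (hdisj hf₁ h₁) (hdisj hf₂ h₂)
    (frontier_subset_closure h)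
  refine (connectedComponentIn_subset _ _).trans (Set.compl_subset_compl.2 ?_)
  rintro q ((⟨u, -, rfl⟩ | hq) | hq | hq)
  · exact Or.inl ⟨u, rfl⟩
  · simp only [Set.mem_iUnion] at hq
    obtain ⟨u, v, h, hq⟩ := hq
    refine Or.inr ?_
    simp only [Set.mem_iUnion]
    exact ⟨u, v, h.1, hq⟩
  all_goals
    refine Or.inr ?_
    simp only [Set.mem_iUnion]
  · exact ⟨x, y, hxy, hq⟩
  · exact ⟨y, z, hyz, hq⟩

end Corner

end Embedding

section Minimality

variable {V : Type} {G H : SimpleGraph V}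

lemma IsPlaneEmbedding.mono {vtx : V → ℝ × ℝ} {arc : V → V → ℝ → ℝ × ℝ} (hle : H ≤ G)
    (hemb : IsPlaneEmbedding G vtx arc) : IsPlaneEmbedding H vtx arc where
  vtx_inj := hemb.vtx_inj
  arc_cont _ _ h := hemb.arc_cont (hle h)
  arc_injOn _ _ h := hemb.arc_injOn (hle h)
  arc_start _ _ h := hemb.arc_start (hle h)
  arc_end _ _ h := hemb.arc_end (hle h)
  arc_symm _ _ h := hemb.arc_symm (hle h)
  arc_avoids_vtx _ _ h := hemb.arc_avoids_vtx (hle h)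
  arc_disjoint _ _ _ _ h h' := hemb.arc_disjoint (hle h) (hle h')

lemma Cycles5Apart.mono (hle : H ≤ G) (hreach : ∀ u v, G.Reachable u v → H.Reachable u v)
    (hG : Cycles5Apart G) : Cycles5Apart H := fun u v c₁ c₂ h₁ h₂ hl₁ hl₂ hne x hx y hy => by
  have h3 : 3 ≤ G.dist x y := hG (c₁.mapLe hle) (c₂.mapLe hle) (h₁.mapLe hle) (h₂.mapLe hle)
    (by simpa using hl₁) (by simpa using hl₂) (by simpa using hne) x (by simpa using hx) y
    (by simpa using hy)
  have hr : G.Reachable x y := Reachable.of_dist_ne_zero (by lia)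
  exact h3.trans ((hreach x y hr).dist_anti hle)

lemma IFColoringOn.mono (hle : H ≤ G) {S : Set V} {c : V → Bool} (hc : IFColoringOn G S c) :
    IFColoringOn H S c :=
  ⟨fun _ _ hu hv h => hc.1 hu hv (hle h), fun v w hw hS hF =>
    hc.2 v (w.mapLe hle) (hw.mapLe hle) (by simpa using hS) (by simpa using hF)⟩

lemma IsGoodCycle.mono (hle : H ≤ G) {v : V} {C : G.Walk v v} {C' : H.Walk v v}
    (hsupp : C'.support = C.support) (hlen : C'.length = C.length) (hC' : C'.IsCycle)
    (hC : IsGoodCycle G C) : IsGoodCycle H C' := by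
  refine ⟨hC', fun hbad => hC.2 ⟨hC.1, hlen ▸ hbad.2.1, ?_⟩⟩
  obtain ⟨-, -, ⟨x, hx, a, b, c, ha, hb, hc, h1, h2, h3, h4, h5, h6⟩ |
    ⟨x, y, z, hx, hy, hz, hxy, hyz, hxz, a, b, c, ha, hb, hc, h1, h2, h3, h4, h5, h6⟩⟩ := hbad
  · rw [hsupp] at hx ha hb hc
    exact Or.inl ⟨x, hx, a, b, c, ha, hb, hc, h1, h2, h3, hle h4, hle h5, hle h6⟩
  · rw [hsupp] at hx hy hz ha hb hc
    exact Or.inr ⟨x, y, z, hx, hy, hz, hle hxy, hle hyz, hle hxz, a, b, c, ha, hb, hc, h1, h2, h3,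
      hle h4, hle h5, hle h6⟩

lemma reachable_deleteEdges_of_mem_cycle {a y z : V} {w : G.Walk a a} (hw : w.IsCycle)
    (he : s(y, z) ∈ w.edges) {u v : V} (h : G.Reachable u v) :
    (G.deleteEdges {s(y, z)}).Reachable u v := by
  have hyz : (G.deleteEdges {s(y, z)}).Reachable y z := by
    by_contra hn
    exact (isBridge_iff_forall_cycle_notMem (w.edges_subset_edgeSet he)).1 (isBridge_iff.2 hn) w hw he
  obtain ⟨p⟩ := h
  induction p with
  | nil => exact Reachable.rfl
  | @cons u t v hut _ ih =>
    refine Reachable.trans ?_ ih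
    by_cases heq : s(u, t) = s(y, z)
    · rcases Sym2.eq_iff.1 heq with ⟨rfl, rfl⟩ | ⟨rfl, rfl⟩
      · exact hyz
      · exact hyz.symm
    · exact Adj.reachable (by rw [deleteEdges_adj]; exact ⟨hut, heq⟩)

/-- A super IF-coloring extends over a deleted edge at a vertex of degree two off `Q`. -/
lemma superIFColoring_of_deleteEdges {Q : Set V} {c : V → Bool} {x y z : V} (hy : y ∉ Q)
    (hxy : G.Adj x y) (hyz : G.Adj y z) (hdeg : ∀ t, G.Adj y t → t = x ∨ t = z)
    (hc : SuperIFColoring (G.deleteEdges {s(y, z)}) Q c) :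
    ∃ c', SuperIFColoring G Q c' ∧ ∀ v ≠ y, c' v = c v := by
  classical
  set c' := Function.update c y (!c x && !c z) with hc'def
  have hc'y : c' y = (!c x && !c z) := by simp [c']
  have hc' : ∀ v ≠ y, c' v = c v := fun v hv => by simp [c', hv]
  have hsub : ∀ {u v : V} {w : G.Walk u v}, y ∉ w.support →
      ∀ e ∈ w.edges, e ∈ (G.deleteEdges {s(y, z)}).edgeSet := by
    intro u v w hyw e he
    rw [edgeSet_deleteEdges]
    refine ⟨w.edges_subset_edgeSet he, ?_⟩
    rintro rfl
    exact hyw (w.fst_mem_support_of_mem_edges he)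
  have hF : ∀ {u v : V} {w : G.Walk u v}, (w.toSubgraph.neighborSet y).ncard = 2 →
      y ∈ w.support → ¬ ∀ v ∈ w.support, c' v = false := by
    intro u v w hcard hyw hall
    have hN : w.toSubgraph.neighborSet y = {x, z} := by
      refine Set.eq_of_subset_of_ncard_le (fun t ht => hdeg t ?_) ?_ (Set.toFinite _)
      · exact w.toSubgraph.adj_sub ht
      · rw [hcard]; exact Set.ncard_insert_le x {z} |>.trans (by simp)
    have hmem : ∀ t ∈ w.toSubgraph.neighborSet y, c t = false := fun t ht => by
      rw [← hc' t (G.ne_of_adj (w.toSubgraph.adj_sub ht)).symm]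
      exact hall t (by simpa using w.toSubgraph.edge_vert (w.toSubgraph.adj_symm ht))
    have := hall y hyw
    simp [hc'y, hmem x (by simp [hN]), hmem z (by simp [hN])] at this
  have hagree : ∀ {u v : V} {w : G.Walk u v}, y ∉ w.support → (∀ v ∈ w.support, c' v = false) →
      ∀ v ∈ w.support, c v = false := fun hyw h v hv => by
    rw [← hc' v (fun h => hyw (h ▸ hv))]; exact h v hv
  refine ⟨c', ⟨⟨fun u v huv hu => ?_, fun v w hw hall => ?_⟩, fun a b p hp => ?_⟩, hc'⟩
  · by_cases huy : u = y
    · subst huy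
      rw [hc' v huv.ne.symm]
      rcases hdeg v huv with rfl | rfl <;> simp_all
    · by_cases hvy : v = y
      · subst hvy
        rw [hc' u huy] at hu
        rcases hdeg u huv.symm with rfl | rfl <;> simp [hc'y, hu]
      · rw [hc' v hvy]
        rw [hc' u huy] at hu
        refine hc.1.1 ?_ hu
        rw [deleteEdges_adj]
        refine ⟨huv, fun h => ?_⟩
        rcases Sym2.eq_iff.1 h with ⟨rfl, -⟩ | ⟨-, rfl⟩ <;> contradiction
  · by_cases hyw : y ∈ w.support
    · exact hF (hw.ncard_neighborSet_toSubgraph_eq_two hyw) hyw hall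
    · exact hc.1.2 v (w.transfer _ (hsub hyw)) (hw.transfer _)
        (by rw [Walk.support_transfer]; exact hagree hyw hall)
  · obtain ⟨hpath, hall, ha, hb, hlen, hint⟩ := hp
    by_cases hyp : y ∈ p.support
    · obtain ⟨i, rfl, hi⟩ := Walk.mem_support_iff_exists_getVert.1 hyp
      refine hF (hpath.ncard_neighborSet_toSubgraph_internal_eq_two (i := i) ?_ ?_) hyp hall
      · rintro rfl; exact hy (by simpa using ha)
      · refine lt_of_le_of_ne hi ?_
        rintro rfl; exact hy (by simpa using hb)
    · refine hc.2 a b (p.transfer _ (hsub hyp)) ⟨hpath.transfer _, ?_, ha, hb, ?_, ?_⟩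
      · rw [Walk.support_transfer]; exact hagree hyp hall
      · rwa [Walk.length_transfer]
      · rwa [Walk.support_transfer]

lemma IsCounterexample.deleteEdges {v₀ : V} {C₀ : G.Walk v₀ v₀} {c₀ : V → Bool}
    (hG : IsCounterexample G C₀ c₀) {x y z : V} (hy : y ∉ C₀.support) (hxy : G.Adj x y)
    (hdeg : ∀ t, G.Adj y t → t = x ∨ t = z) {a : V} {w : G.Walk a a} (hw : w.IsCycle)
    (hyz : s(y, z) ∈ w.edges) :
    ∃ C : (G.deleteEdges {s(y, z)}).Walk v₀ v₀,
      IsCounterexample (G.deleteEdges {s(y, z)}) C c₀ := by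
  have hle : G.deleteEdges {s(y, z)} ≤ G := deleteEdges_le _
  have hmem : ∀ e ∈ C₀.edges, e ∈ (G.deleteEdges {s(y, z)}).edgeSet := by
    intro e he
    rw [edgeSet_deleteEdges]
    refine ⟨C₀.edges_subset_edgeSet he, ?_⟩
    rintro rfl
    exact hy (C₀.fst_mem_support_of_mem_edges he)
  obtain ⟨⟨vtx, arc, hemb⟩, hapart, hgood, hlen, hcol, hext⟩ := hG
  refine ⟨C₀.transfer _ hmem, ⟨vtx, arc, hemb.mono hle⟩,
    hapart.mono hle fun u v => reachable_deleteEdges_of_mem_cycle hw hyz,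
    hgood.mono hle (by simp) (by simp) (hgood.1.transfer _), by simpa using hlen, ?_, ?_⟩
  · simpa using hcol.mono hle
  · rintro ⟨c, hc, hc₀⟩
    simp only [Walk.support_transfer] at hc hc₀
    obtain ⟨c', hc', hcc'⟩ := superIFColoring_of_deleteEdges (Q := {x | x ∈ C₀.support}) hy hxy
      (w.adj_of_mem_edges hyz) hdeg hc
    exact hext ⟨c', hc', fun v hv => by rw [hcc' v (fun h => hy (h ▸ hv)), hc₀ v hv]⟩

section Transport

variable {W : Type} {G' : SimpleGraph W} (φ : G ≃g G')

lemma _root_.SimpleGraph.Iso.dist_eq (u v : V) : G'.dist (φ u) (φ v) = G.dist u v := by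
  have hle : ∀ {V W : Type} {G : SimpleGraph V} {G' : SimpleGraph W} (φ : G ≃g G') (u v : V),
      G.Reachable u v → G'.dist (φ u) (φ v) ≤ G.dist u v := fun φ u v h => by
    obtain ⟨p, hp⟩ := h.exists_walk_length_eq_dist
    rw [← hp, ← Walk.length_map φ.toHom p]
    exact dist_le _
  by_cases h : G.Reachable u v
  · refine le_antisymm (hle φ u v h) ?_
    simpa using hle φ.symm (φ u) (φ v) (h.map φ.toHom)
  · rw [dist_eq_zero_of_not_reachable h, dist_eq_zero_of_not_reachable]
    rwa [Iso.reachable_iff]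

lemma IsPlanarGraph.iso (φ : G ≃g G') (hG : IsPlanarGraph G) : IsPlanarGraph G' := by
  obtain ⟨vtx, arc, hemb⟩ := hG
  have hadj : ∀ {u v}, G'.Adj u v → G.Adj (φ.symm u) (φ.symm v) := φ.symm.map_adj_iff.2
  refine ⟨fun w => vtx (φ.symm w), fun u v => arc (φ.symm u) (φ.symm v), ?_⟩
  exact
    { vtx_inj := hemb.vtx_inj.comp φ.symm.injective
      arc_cont := fun _ _ h => hemb.arc_cont (hadj h)
      arc_injOn := fun _ _ h => hemb.arc_injOn (hadj h)
      arc_start := fun _ _ h => hemb.arc_start (hadj h)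
      arc_end := fun _ _ h => hemb.arc_end (hadj h)
      arc_symm := fun _ _ h => hemb.arc_symm (hadj h)
      arc_avoids_vtx := fun _ _ h w => hemb.arc_avoids_vtx (hadj h) _
      arc_disjoint := fun _ _ _ _ h h' hne => hemb.arc_disjoint (hadj h) (hadj h') fun heq =>
        hne (Sym2.map.injective φ.symm.injective (by simpa using heq)) }

lemma Cycles5Apart.iso (φ : G ≃g G') (hG : Cycles5Apart G) : Cycles5Apart G' :=
    fun u v c₁ c₂ h₁ h₂ hl₁ hl₂ hne x hx y hy => by
  have hinj := φ.symm.injective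
  rw [← φ.symm.dist_eq]
  refine hG (c₁.map φ.symm.toHom) (c₂.map φ.symm.toHom) (h₁.map hinj) (h₂.map hinj)
    (by simpa using hl₁) (by simpa using hl₂) (fun heq => hne ?_) _
    (by simpa using hx) _ (by simpa using hy)
  ext e
  have := Set.ext_iff.1 heq (e.map φ.symm)
  simpa [Walk.edges_map, (Sym2.map.injective hinj).eq_iff] using this

lemma mem_support_map_iso {u v : V} {p : G.Walk u v} {w : W} :
    w ∈ (p.map φ.toHom).support ↔ φ.symm w ∈ p.support := by
  rw [Walk.support_map, List.mem_map]
  constructor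
  · rintro ⟨t, ht, rfl⟩
    simpa using ht
  · exact fun h => ⟨_, h, by simp⟩

lemma IsGoodCycle.iso {v : V} {C : G.Walk v v} (hC : IsGoodCycle G C) :
    IsGoodCycle G' (C.map φ.toHom) := by
  have hadj : ∀ {u v}, G'.Adj u v → G.Adj (φ.symm u) (φ.symm v) := φ.symm.map_adj_iff.2
  have hne : ∀ {u v}, u ≠ v → φ.symm u ≠ φ.symm v := φ.symm.injective.ne
  refine ⟨hC.1.map φ.injective, fun hbad => hC.2 ⟨hC.1, by simpa using hbad.2.1, ?_⟩⟩
  obtain ⟨-, -, ⟨x, hx, a, b, c, ha, hb, hc, h1, h2, h3, h4, h5, h6⟩ |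
    ⟨x, y, z, hx, hy, hz, hxy, hyz, hxz, a, b, c, ha, hb, hc, h1, h2, h3, h4, h5, h6⟩⟩ := hbad
  · rw [mem_support_map_iso] at hx ha hb hc
    exact Or.inl ⟨_, hx, _, _, _, ha, hb, hc, hne h1, hne h2, hne h3, hadj h4, hadj h5, hadj h6⟩
  · rw [mem_support_map_iso] at hx hy hz ha hb hc
    exact Or.inr ⟨_, _, _, hx, hy, hz, hadj hxy, hadj hyz, hadj hxz, _, _, _, ha, hb, hc,
      hne h1, hne h2, hne h3, hadj h4, hadj h5, hadj h6⟩

lemma IFColoringOn.iso {S : Set V} {c : V → Bool} (hc : IFColoringOn G S c) :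
    IFColoringOn G' (φ.symm ⁻¹' S) (c ∘ φ.symm) := by
  refine ⟨fun u v hu hv h => hc.1 hu hv (φ.symm.map_adj_iff.2 h), fun v w hw hS hF =>
    hc.2 _ (w.map φ.symm.toHom) (hw.map φ.symm.injective) ?_ ?_⟩
  · simpa using hS
  · simpa using hF

lemma SuperIFColoring.iso {Q : Set V} {c : V → Bool} (hc : SuperIFColoring G Q c) :
    SuperIFColoring G' (φ.symm ⁻¹' Q) (c ∘ φ.symm) := by
  refine ⟨⟨fun u v h => hc.1.1 (φ.symm.map_adj_iff.2 h), fun v w hw hF =>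
    hc.1.2 _ (w.map φ.symm.toHom) (hw.map φ.symm.injective) (by simpa using hF)⟩, ?_⟩
  rintro a b p ⟨hp, hF, ha, hb, hl, hint⟩
  refine hc.2 _ _ (p.map φ.symm.toHom)
    ⟨hp.map φ.symm.injective, by simpa using hF, ha, hb, by simpa using hl, ?_⟩
  simpa using hint

lemma IsCounterexample.iso {v₀ : V} {C₀ : G.Walk v₀ v₀} {c₀ : V → Bool}
    (hG : IsCounterexample G C₀ c₀) : IsCounterexample G' (C₀.map φ.toHom) (c₀ ∘ φ.symm) := by
  obtain ⟨hplanar, hapart, hgood, hlen, hcol, hext⟩ := hG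
  have hset : {w | w ∈ (C₀.map φ.toHom).support} = φ.symm ⁻¹' {x | x ∈ C₀.support} := by
    ext w; exact mem_support_map_iso φ
  refine ⟨hplanar.iso φ, hapart.iso φ, hgood.iso φ, by simpa using hlen, ?_, ?_⟩
  · rw [hset]; exact hcol.iso φ
  · rintro ⟨c, hc, hcc⟩
    rw [hset] at hc
    refine hext ⟨c ∘ φ, ?_, fun x hx => ?_⟩
    · have := hc.iso φ.symm
      rwa [← Set.preimage_comp, show (φ.symm ∘ φ.symm.symm : V → V) = id by ext; simp] at this
    · have := hcc (φ x) (by rw [mem_support_map_iso]; simpa using hx)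
      simpa using this

end Transport

/-- In a minimal counterexample no vertex off the outer cycle that lies on a cycle has
degree two. -/
theorem IsMinimalCounterexample.exists_third_neighbor [Fintype V] {v₀ : V} {C₀ : G.Walk v₀ v₀}
    {c₀ : V → Bool} (hG : IsMinimalCounterexample G C₀ c₀) {x y z : V} (hy : y ∉ C₀.support)
    (hxy : G.Adj x y) {a : V} {w : G.Walk a a} (hw : w.IsCycle) (hyz : s(y, z) ∈ w.edges) :
    ∃ t, G.Adj y t ∧ t ≠ x ∧ t ≠ z := by
  by_contra! hdeg
  obtain ⟨C, hC⟩ := hG.1.deleteEdges hy hxy (fun t ht => or_iff_not_imp_left.2 (hdeg t ht)) hw hyz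
  let e := Fintype.equivFin V
  let φ := Iso.map e (G.deleteEdges {s(y, z)})
  have hle := hG.2 _ _ _ _ _ (hC.iso φ)
  have hcard : (((G.deleteEdges {s(y, z)}).map e.toEmbedding).edgeSet).ncard <
      G.edgeSet.ncard := by
    rw [edgeSet_map, Set.ncard_image_of_injective _ (Function.Embedding.injective _),
      edgeSet_deleteEdges]
    exact Set.ncard_sdiff_singleton_lt_of_mem (w.edges_subset_edgeSet hyz) (Set.toFinite _)
  simp only [graphSize, Fintype.card_fin] at hle
  have := hle.trans_lt (Nat.add_lt_add_left hcard _)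
  exact lt_irrefl _ this

end Minimality

section ShortCycles

variable {V : Type} {G : SimpleGraph V}

lemma IsCycle.mem_support_iff_exists_edge {a t : V} {w : G.Walk a a} (hw : w.IsCycle) :
    t ∈ w.support ↔ ∃ u, s(t, u) ∈ w.edges := by
  constructor
  · intro ht
    have hcard := hw.ncard_neighborSet_toSubgraph_eq_two ht
    obtain ⟨u, hu⟩ : (w.toSubgraph.neighborSet t).Nonempty :=
      Set.nonempty_of_ncard_ne_zero (by lia)
    exact ⟨u, by rwa [Subgraph.mem_neighborSet, Walk.adj_toSubgraph_iff_mem_edges] at hu⟩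
  · rintro ⟨u, hu⟩
    exact w.fst_mem_support_of_mem_edges hu

/-- Removing an edge from a cycle leaves a path. -/
lemma IsCycle.exists_isPath_of_mem_edges {a x y : V} {w : G.Walk a a} (hw : w.IsCycle)
    (h : s(x, y) ∈ w.edges) :
    ∃ p : G.Walk y x, p.IsPath ∧ s(x, y) ∉ p.edges ∧ p.length + 1 = w.length ∧
      (∀ v, v ∈ w.support ↔ v ∈ p.support) ∧ ∀ e, e ∈ w.edges ↔ e = s(x, y) ∨ e ∈ p.edges := by
  classical
  have hx := w.fst_mem_support_of_mem_edges h
  obtain ⟨w', hw', hs, he, hl⟩ : ∃ w' : G.Walk x x, w'.IsCycle ∧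
      (∀ v, v ∈ w.support ↔ v ∈ w'.support) ∧ (∀ e, e ∈ w.edges ↔ e ∈ w'.edges) ∧
      w'.length = w.length := by
    have hc := hw.rotate hx
    have he : ∀ e, e ∈ w.edges ↔ e ∈ (w.rotate x hx).edges := fun e =>
      (w.rotate_edges x hx).mem_iff.symm
    refine ⟨w.rotate x hx, hc, fun v => ?_, he, by simp⟩
    rw [IsCycle.mem_support_iff_exists_edge hw, IsCycle.mem_support_iff_exists_edge hc]
    simp only [he]
  obtain ⟨w'', hw'', hs', he', hl', hsnd⟩ : ∃ w'' : G.Walk x x, w''.IsCycle ∧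
      (∀ v, v ∈ w.support ↔ v ∈ w''.support) ∧ (∀ e, e ∈ w.edges ↔ e ∈ w''.edges) ∧
      w''.length = w.length ∧ w''.snd = y := by
    have hor := IsCycle.eq_or_eq_of_edge_mem (y := x) (t := y) hw' hw'.snd_ne_penultimate
      (by rw [Sym2.eq_swap]; exact Walk.mk_start_snd_mem_edges hw'.not_nil)
      (by rw [Sym2.eq_swap]; exact Walk.mk_penultimate_end_mem_edges hw'.not_nil)
      ((he _).1 h)
    rcases hor with rfl | rfl
    · exact ⟨w', hw', hs, he, hl, rfl⟩
    · exact ⟨w'.reverse, hw'.reverse, by simpa using hs, by simpa using he, by simpa using hl,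
        by simp⟩
  cases w'' with
  | nil => exact (Walk.not_isCycle_nil hw'').elim
  | cons hadj p =>
    rw [Walk.snd_cons] at hsnd
    subst hsnd
    rw [Walk.cons_isCycle_iff] at hw''
    refine ⟨p, hw''.1, hw''.2, by simpa using hl', fun v => ?_, fun e => ?_⟩
    · rw [hs', Walk.support_cons, List.mem_cons]
      exact or_iff_right_of_imp fun h => by rw [h]; exact p.end_mem_support
    · rw [he', Walk.edges_cons, List.mem_cons]

/-- Every cycle of length at most five through a vertex of `N` has vertex set `S`. -/
def ShortCyclesNear (G : SimpleGraph V) (N S : Set V) : Prop :=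
  ∀ ⦃r : V⦄ (w : G.Walk r r), w.IsCycle → w.length ≤ 5 → ∀ v ∈ w.support, v ∈ N →
    ∀ t, t ∈ w.support ↔ t ∈ S

lemma ShortCyclesNear.triangle {N S : Set V} (h : ShortCyclesNear G N S) {a b c : V}
    (ha : a ∈ N) (hab : G.Adj a b) (hbc : G.Adj b c) (hca : G.Adj c a) (t : V) :
    t ∈ S ↔ t = a ∨ t = b ∨ t = c := by
  have hw : (Walk.cons hab (.cons hbc (.cons hca .nil))).IsCycle := by
    simp [Walk.cons_isCycle_iff, hab.ne, hbc.ne, hca.ne, hab.ne.symm, hca.ne.symm]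
  rw [← h _ hw (by simp) a (by simp) ha]
  simp
  tauto

lemma ShortCyclesNear.quadrilateral {N S : Set V} (h : ShortCyclesNear G N S) {a b c d : V}
    (ha : a ∈ N) (hab : G.Adj a b) (hbc : G.Adj b c) (hcd : G.Adj c d) (hda : G.Adj d a)
    (hac : a ≠ c) (hbd : b ≠ d) (t : V) :
    t ∈ S ↔ t = a ∨ t = b ∨ t = c ∨ t = d := by
  have hw : (Walk.cons hab (.cons hbc (.cons hcd (.cons hda .nil)))).IsCycle := by
    simp [Walk.cons_isCycle_iff, hab.ne, hbc.ne, hcd.ne, hda.ne, hab.ne.symm,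
      hda.ne.symm, hac, hac.symm, hbd]
  rw [← h _ hw (by simp) a (by simp) ha]
  simp
  tauto

lemma ShortCyclesNear.pentagon {N S : Set V} (h : ShortCyclesNear G N S) {a b c d e : V}
    (ha : a ∈ N) (hab : G.Adj a b) (hbc : G.Adj b c) (hcd : G.Adj c d) (hde : G.Adj d e)
    (hea : G.Adj e a) (hac : a ≠ c) (had : a ≠ d) (hbd : b ≠ d) (hbe : b ≠ e) (hce : c ≠ e)
    (t : V) : t ∈ S ↔ t = a ∨ t = b ∨ t = c ∨ t = d ∨ t = e := by
  have hw : (Walk.cons hab (.cons hbc (.cons hcd (.cons hde (.cons hea .nil))))).IsCycle := by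
    simp [Walk.cons_isCycle_iff, hab.ne, hbc.ne, hcd.ne, hde.ne, hea.ne, hab.ne.symm,
      hea.ne.symm, hac, hac.symm, had, had.symm, hbd, hbe, hce]
  rw [← h _ hw (by simp) a (by simp) ha]
  simp
  tauto

lemma ShortCyclesNear.mono {N N' S : Set V} (h : ShortCyclesNear G N S) (hN : N' ⊆ N) :
    ShortCyclesNear G N' S := fun _ w hw hl v hv hvN => h w hw hl v hv (hN hvN)

lemma Cycles5Apart.shortCyclesNear (hG : Cycles5Apart G) {b : V} {w : G.Walk b b}
    (hw : w.IsCycle) (hl : w.length ≤ 5) :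
    ShortCyclesNear G {v | ∃ u ∈ w.support, G.dist v u ≤ 2} {v | v ∈ w.support} := by
  rintro r w' hw' hl' v hv ⟨u, hu, hd⟩ t
  by_cases heq : {e : Sym2 V | e ∈ w'.edges} = {e : Sym2 V | e ∈ w.edges}
  · rw [Set.mem_ofPred_eq, IsCycle.mem_support_iff_exists_edge hw,
      IsCycle.mem_support_iff_exists_edge hw']
    exact exists_congr fun s => Set.ext_iff.1 heq s(t, s)
  · have := hG w' w hw' hw hl' hl heq v hv u hu
    lia

lemma ShortCyclesNear.not_adj {N S : Set V} (h : ShortCyclesNear G N S) {a b c t : V}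
    (ha : a ∈ N) (hab : G.Adj a b) (hbc : G.Adj b c) (ht : t ∈ S) (hta : t ≠ a) (htb : t ≠ b)
    (htc : t ≠ c) : ¬ G.Adj a c := fun hac => by
  simpa [hta, htb, htc] using (h.triangle ha hab hbc hac.symm t).1 ht

/-- If all short cycles through the vertices of a hexagon have the same vertex set, then the
hexagon has no chord at its first vertex. -/
lemma ShortCyclesNear.hexagon_not_adj {N S : Set V} (h : ShortCyclesNear G N S)
    {v₀ v₁ v₂ v₃ v₄ v₅ : V} (h₀ : v₀ ∈ N) (h₀₁ : G.Adj v₀ v₁) (h₁₂ : G.Adj v₁ v₂)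
    (h₂₃ : G.Adj v₂ v₃) (h₃₄ : G.Adj v₃ v₄) (h₄₅ : G.Adj v₄ v₅) (h₅₀ : G.Adj v₅ v₀)
    (hd : [v₀, v₁, v₂, v₃, v₄, v₅].Nodup) : ¬ G.Adj v₀ v₂ ∧ ¬ G.Adj v₀ v₃ := by
  simp only [List.nodup_cons, List.mem_cons, List.not_mem_nil, not_or, or_false] at hd
  obtain ⟨⟨_, d02, d03, d04, d05⟩, ⟨_, d13, d14, d15⟩, ⟨_, d24, d25⟩, ⟨_, d35⟩, -⟩ := hd
  refine ⟨fun hadj => ?_, fun hadj => ?_⟩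
  · have h3 := h.triangle h₀ h₀₁ h₁₂ hadj.symm v₁
    have h5 := h.pentagon h₀ hadj h₂₃ h₃₄ h₄₅ h₅₀ d03 d04 d24 d25 d35 v₁
    grind [h₀₁.ne, h₁₂.ne]
  · have h4 := h.quadrilateral h₀ h₀₁ h₁₂ h₂₃ hadj.symm d02 d13 v₁
    have h4' := h.quadrilateral h₀ hadj h₃₄ h₄₅ h₅₀ d04 d35 v₁
    grind [h₀₁.ne, h₁₂.ne]

lemma ShortCyclesNear.hexagon_chordless {N S : Set V} (h : ShortCyclesNear G N S)
    {v₀ v₁ v₂ v₃ v₄ v₅ : V} (hN : ∀ v ∈ [v₀, v₁, v₂, v₃, v₄, v₅], v ∈ N)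
    (h₀₁ : G.Adj v₀ v₁) (h₁₂ : G.Adj v₁ v₂)
    (h₂₃ : G.Adj v₂ v₃) (h₃₄ : G.Adj v₃ v₄) (h₄₅ : G.Adj v₄ v₅) (h₅₀ : G.Adj v₅ v₀)
    (hd : [v₀, v₁, v₂, v₃, v₄, v₅].Nodup) {u v : V} (hu : u ∈ [v₀, v₁, v₂, v₃, v₄, v₅])
    (hv : v ∈ [v₀, v₁, v₂, v₃, v₄, v₅]) (huv : G.Adj u v) :
    s(u, v) ∈ [s(v₀, v₁), s(v₁, v₂), s(v₂, v₃), s(v₃, v₄), s(v₄, v₅), s(v₅, v₀)] := by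
  have hd1 : [v₁, v₂, v₃, v₄, v₅, v₀].Nodup := (List.nodup_rotate (n := 1)).2 hd
  have hd2 : [v₂, v₃, v₄, v₅, v₀, v₁].Nodup := (List.nodup_rotate (n := 2)).2 hd
  have hd3 : [v₃, v₄, v₅, v₀, v₁, v₂].Nodup := (List.nodup_rotate (n := 3)).2 hd
  have hd4 : [v₄, v₅, v₀, v₁, v₂, v₃].Nodup := (List.nodup_rotate (n := 4)).2 hd
  have hd5 : [v₅, v₀, v₁, v₂, v₃, v₄].Nodup := (List.nodup_rotate (n := 5)).2 hd
  have k0 := h.hexagon_not_adj (hN v₀ (by simp)) h₀₁ h₁₂ h₂₃ h₃₄ h₄₅ h₅₀ hd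
  have k1 := h.hexagon_not_adj (hN v₁ (by simp)) h₁₂ h₂₃ h₃₄ h₄₅ h₅₀ h₀₁ hd1
  have k2 := h.hexagon_not_adj (hN v₂ (by simp)) h₂₃ h₃₄ h₄₅ h₅₀ h₀₁ h₁₂ hd2
  have k3 := h.hexagon_not_adj (hN v₃ (by simp)) h₃₄ h₄₅ h₅₀ h₀₁ h₁₂ h₂₃ hd3
  have k4 := h.hexagon_not_adj (hN v₄ (by simp)) h₄₅ h₅₀ h₀₁ h₁₂ h₂₃ h₃₄ hd4
  have k5 := h.hexagon_not_adj (hN v₅ (by simp)) h₅₀ h₀₁ h₁₂ h₂₃ h₃₄ h₄₅ hd5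
  simp only [List.mem_cons, List.not_mem_nil, or_false] at hu hv
  clear hd hd1 hd2 hd3 hd4 hd5 hN
  rcases hu with rfl | rfl | rfl | rfl | rfl | rfl <;>
  rcases hv with rfl | rfl | rfl | rfl | rfl | rfl <;>
  first
  | (simp; done)
  | exact (huv.ne rfl).elim
  | exact (k0.1 huv).elim | exact (k0.2 huv).elim | exact (k1.1 huv).elim
  | exact (k1.2 huv).elim | exact (k2.1 huv).elim | exact (k2.2 huv).elim
  | exact (k3.1 huv).elim | exact (k3.2 huv).elim | exact (k4.1 huv).elim
  | exact (k4.2 huv).elim | exact (k5.1 huv).elim | exact (k5.2 huv).elim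
  | exact (k0.1 huv.symm).elim | exact (k1.1 huv.symm).elim | exact (k2.1 huv.symm).elim
  | exact (k3.1 huv.symm).elim | exact (k4.1 huv.symm).elim | exact (k5.1 huv.symm).elim

/-- The vertex `v` is reached from `y` within `S`, avoiding `x`, by a path of length at most two, or
by a path of length three if `v` is a neighbor of `x`. -/
def Reaches (G : SimpleGraph V) (S : Set V) (y x v : V) : Prop :=
  G.Adj y v ∨ (∃ q ∈ S, q ≠ x ∧ G.Adj y q ∧ G.Adj q v) ∨
    (G.Adj v x ∧ ∃ q ∈ S, ∃ q' ∈ S, q ≠ x ∧ q' ≠ x ∧ q' ≠ y ∧ q ≠ v ∧ G.Adj y q ∧ G.Adj q q' ∧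
      G.Adj q' v)

lemma Walk.IsPath.reaches {x y : V} {p : G.Walk y x} (hp : p.IsPath) (hl : p.length ≤ 4)
    {v : V} (hv : v ∈ p.support) (hvx : v ≠ x) (hvy : v ≠ y) :
    Reaches G {u | u ∈ p.support} y x v := by
  unfold Reaches
  match p with
  | .nil => simp_all
  | .cons h₁ .nil => simp_all
  | .cons h₁ (.cons h₂ .nil) =>
    simp_all
  | .cons h₁ (.cons h₂ (.cons h₃ .nil)) =>
    simp [Walk.cons_isPath_iff] at hp hv ⊢
    grind
  | .cons h₁ (.cons h₂ (.cons h₃ (.cons h₄ .nil))) =>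
    simp [Walk.cons_isPath_iff] at hp hv ⊢
    grind
  | .cons _ (.cons _ (.cons _ (.cons _ (.cons _ _)))) =>
    simp only [Walk.length_cons] at hl
    lia

/-- A short cycle near which all short cycles have the same vertex set has no chords. -/
lemma ShortCyclesNear.path_chordless {x y : V} {p : G.Walk y x} (hp : p.IsPath)
    (hl : p.length ≤ 4) (hxy : G.Adj x y) {N : Set V} (h : ShortCyclesNear G N {v | v ∈ p.support})
    (hN : ∀ v ∈ p.support, v ∈ N) {u v : V} (hu : u ∈ p.support) (hv : v ∈ p.support)
    (huv : G.Adj u v) : s(u, v) = s(x, y) ∨ s(u, v) ∈ p.edges := by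
  have key : ∀ {a b c t : V}, a ∈ p.support → t ∈ p.support → G.Adj a b → G.Adj b c → t ≠ a →
      t ≠ b → t ≠ c → ¬ G.Adj a c := fun ha ht hab hbc hta htb htc =>
    h.not_adj (hN _ ha) hab hbc ht hta htb htc
  have hne := huv.ne
  clear h hN
  match p with
  | .nil => simp_all
  | .cons h₁ .nil => simp at hu hv ⊢; grind
  | .cons (v := q) h₁ (.cons h₂ .nil) =>
    simp at hu hv ⊢
    grind
  | .cons (v := q) h₁ (.cons (v := r) h₂ (.cons h₃ .nil)) =>
    simp [Walk.cons_isPath_iff] at hp hu hv key ⊢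
    have k1 := @key y q r x
    have k2 := @key q r x y
    grind [G.adj_comm]
  | .cons (v := q) h₁ (.cons (v := r) h₂ (.cons (v := t) h₃ (.cons h₄ .nil))) =>
    simp [Walk.cons_isPath_iff] at hp hu hv key ⊢
    have k1 := @key y q r x
    have k2 := @key q r t x
    have k3 := @key r t x y
    have k4 := @key t x y q
    have k5 := @key x y q r
    grind [G.adj_comm]
  | .cons _ (.cons _ (.cons _ (.cons _ (.cons _ _)))) =>
    simp only [Walk.length_cons] at hl
    lia

lemma Walk.IsPath.exists_of_length_eq_five {x y : V} {p : G.Walk y x} (hp : p.IsPath)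
    (hl : p.length = 5) : ∃ a b c d : V, G.Adj y a ∧ G.Adj a b ∧ G.Adj b c ∧ G.Adj c d ∧
      G.Adj d x ∧ [y, a, b, c, d, x].Nodup ∧ p.support = [y, a, b, c, d, x] ∧
      p.edges = [s(y, a), s(a, b), s(b, c), s(c, d), s(d, x)] := by
  match p with
  | .cons (v := a) h₁ (.cons (v := b) h₂ (.cons (v := c) h₃ (.cons (v := d) h₄ (.cons h₅ .nil)))) =>
    exact ⟨a, b, c, d, h₁, h₂, h₃, h₄, h₅, hp.support_nodup, by simp, by simp⟩

/-- The first two inner vertices of the path `y a b c d x` avoid a short cycle through `yx`. -/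
lemma ShortCyclesNear.notMem {N S : Set V} (h : ShortCyclesNear G N S) {x y a b : V}
    (haN : a ∈ N) (hya : G.Adj y a) (hab : G.Adj a b) (hyb : ¬ G.Adj y b) (hbx : ¬ G.Adj b x)
    (hby : b ≠ y) (ha : a ∉ S) (hS : b ∈ S → Reaches G S y x b) : b ∉ S := by
  intro hb
  rcases hS hb with h1 | ⟨q, hq, -, hyq, hqb⟩ | ⟨h1, -⟩
  · exact hyb h1
  · exact ha ((h.quadrilateral haN hab hqb.symm hyq.symm hya (by grind) hby a).2 (by simp))
  · exact hbx h1

/-- No edge joins the first two inner vertices of the path `y a b c d x` to a short cycle through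
`yx`, except at `y`. -/
lemma ShortCyclesNear.not_adj_of_reaches {N S : Set V} (h : ShortCyclesNear G N S)
    {x y a b c d v : V} (haN : a ∈ N) (hbN : b ∈ N) (hya : G.Adj y a) (hab : G.Adj a b)
    (hbc : G.Adj b c) (hcd : G.Adj c d) (hdx : G.Adj d x) (hd : [y, a, b, c, d, x].Nodup)
    (ha : a ∉ S) (hb : b ∉ S) (hc : c ∉ S) (hd' : d ∉ S) (hv : v ∈ S) (hvy : v ≠ y)
    (hS : Reaches G S y x v) : ¬ G.Adj a v ∧ ¬ G.Adj b v := by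
  simp only [List.nodup_cons, List.mem_cons, List.not_mem_nil, not_or, or_false] at hd
  have hne : ∀ {s t : V}, s ∉ S → t ∈ S → s ≠ t := fun hs ht hst => hs (hst ▸ ht)
  refine ⟨fun hav => ?_, fun hbv => ?_⟩
  · rcases hS with h1 | ⟨q, hq, -, hyq, hqv⟩ | ⟨-, q, hq, q', hq', -, -, hqy', hqv, hyq, hqq, hqv'⟩
    · exact ha ((h.triangle haN hav h1.symm hya a).2 (by simp))
    · exact ha ((h.quadrilateral haN hav hqv.symm hyq.symm hya (hne ha hq) hvy a).2 (by simp))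
    · exact ha ((h.pentagon haN hav hqv'.symm hqq.symm hyq.symm hya (hne ha hq') (hne ha hq)
        hqv.symm hvy hqy' a).2 (by simp))
  · rcases hS with h1 | ⟨q, hq, -, hyq, hqv⟩ | ⟨h1, -⟩
    · exact hb ((h.quadrilateral hbN hbv h1.symm hya hab (by grind) (hne ha hv).symm b).2
        (by simp))
    · exact hb ((h.pentagon hbN hbv hqv.symm hyq.symm hya hab (hne hb hq) (by grind)
        hvy (hne ha hv).symm (hne ha hq).symm b).2 (by simp))
    · exact hb ((h.pentagon hbN hbc hcd hdx h1.symm hbv.symm (by grind) (by grind) (by grind)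
        (hne hc hv) (hne hd' hv) b).2 (by simp))

end ShortCycles

section NormalAdjacency

variable {V : Type} {G : SimpleGraph V}

/-- If a hexagon and a cycle of length at most five share an edge but no two consecutive edges, in
a graph whose cycles of length at most five are far apart, then they are normally adjacent, the
shared edge is the only chord of the remaining cycle, and no other vertex of the hexagon lies on a
cycle of length at most five. -/
theorem Cycles5Apart.hexagon_normally_adjacent (hG : Cycles5Apart G) {a₁ a₂ x y : V}
    {w₁ : G.Walk a₁ a₁} {w₂ : G.Walk a₂ a₂} (hw₁ : w₁.IsCycle) (hw₂ : w₂.IsCycle)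
    (hl₁ : w₁.length = 6) (hl₂ : w₂.length ≤ 5) (hxy : G.Adj x y) (he₁ : s(x, y) ∈ w₁.edges)
    (he₂ : s(x, y) ∈ w₂.edges)
    (hcorner : ∀ ⦃u v t : V⦄, u ≠ t → s(u, v) ∈ w₁.edges → s(v, t) ∈ w₁.edges →
      s(u, v) ∈ w₂.edges → s(v, t) ∉ w₂.edges) :
    ({e : Sym2 V | e ∈ w₁.edges} ∩ {e : Sym2 V | e ∈ w₂.edges} = {s(x, y)}) ∧
    ({z : V | z ∈ w₁.support} ∩ {z : V | z ∈ w₂.support} = {x, y}) ∧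
    (∃ (r : V) (c : G.Walk r r), c.IsCycle ∧
      (∀ z : V, z ∈ c.support ↔ (z ∈ w₁.support ∨ z ∈ w₂.support)) ∧
      (∀ e ∈ c.edges, e ∈ G.edgeSet) ∧
      (∃! e : Sym2 V, e ∈ G.edgeSet ∧
        (∀ z ∈ e, z ∈ w₁.support ∨ z ∈ w₂.support) ∧ e ∉ c.edges)) ∧
    (∀ z ∈ w₁.support, z ≠ x → z ≠ y →
      ∀ (r : V) (cw : G.Walk r r), cw.IsCycle → cw.length ≤ 5 →
        z ∉ cw.support) := by
  obtain ⟨p₁, hp₁, hep₁, hlp₁, hs₁, hes₁⟩ := IsCycle.exists_isPath_of_mem_edges hw₁ he₁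
  obtain ⟨p₂, hp₂, hep₂, hlp₂, hs₂, hes₂⟩ := IsCycle.exists_isPath_of_mem_edges hw₂ he₂
  have hl2 : p₂.length ≤ 4 := by lia
  obtain ⟨a, b, c, d, hya, hab, hbc, hcd, hdx, hnd, hsp, hepp⟩ :=
    Walk.IsPath.exists_of_length_eq_five hp₁ (by lia)
  have hnd' : [x, d, c, b, a, y].Nodup := by
    rw [← List.nodup_reverse]
    exact hnd
  have hx₂ : x ∈ p₂.support := p₂.end_mem_support
  have hy₂ : y ∈ p₂.support := p₂.start_mem_support
  have hnear : ShortCyclesNear G {v | v ∈ p₁.support ∨ v ∈ p₂.support} {v | v ∈ p₂.support} := by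
    simp only [← hs₂]
    refine (hG.shortCyclesNear hw₂ hl₂).mono ?_
    rintro v (hv | hv)
    · have hxw := (hs₂ x).2 hx₂
      have hyw := (hs₂ y).2 hy₂
      simp only [hsp, List.mem_cons, List.not_mem_nil, or_false] at hv
      rcases hv with rfl | rfl | rfl | rfl | rfl | rfl
      · exact ⟨v, hyw, by simp⟩
      · exact ⟨y, hyw, (dist_le (.cons hya.symm .nil)).trans (by simp)⟩
      · exact ⟨y, hyw, (dist_le (.cons hab.symm (.cons hya.symm .nil))).trans (by simp)⟩
      · exact ⟨x, hxw, (dist_le (.cons hcd (.cons hdx .nil))).trans (by simp)⟩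
      · exact ⟨x, hxw, (dist_le (.cons hdx .nil)).trans (by simp)⟩
      · exact ⟨v, hxw, by simp⟩
    · exact ⟨v, hv, by simp⟩
  have hN : ∀ v ∈ [y, a, b, c, d, x], v ∈ {v | v ∈ p₁.support ∨ v ∈ p₂.support} := fun v hv =>
    Or.inl (hsp ▸ hv)
  have hchord₁ : ∀ {u v : V}, u ∈ p₁.support → v ∈ p₁.support → G.Adj u v →
      s(u, v) = s(x, y) ∨ s(u, v) ∈ p₁.edges := by
    intro u v hu hv huv
    rw [hsp] at hu hv
    have := hnear.hexagon_chordless hN hya hab hbc hcd hdx hxy hnd hu hv huv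
    simp only [hepp, List.mem_cons, List.not_mem_nil, or_false] at this ⊢
    tauto
  have hchord₂ : ∀ {u v : V}, u ∈ p₂.support → v ∈ p₂.support → G.Adj u v →
      s(u, v) = s(x, y) ∨ s(u, v) ∈ p₂.edges := fun hu hv huv =>
    hnear.path_chordless hp₂ hl2 hxy (fun _ => Or.inr) hu hv huv
  have hreach : ∀ {v : V}, v ∈ p₂.support → v ≠ x → v ≠ y →
      Reaches G {u | u ∈ p₂.support} y x v := fun hv hvx hvy => 
    Walk.IsPath.reaches hp₂ hl2 hv hvx hvy
  have hreach' : ∀ {v : V}, v ∈ p₂.support → v ≠ x → v ≠ y →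
      Reaches G {u | u ∈ p₂.support} x y v := fun hv hvx hvy => by
    simpa using Walk.IsPath.reaches hp₂.reverse (by simpa using hl2) (by simpa using hv) hvy hvx
  have hne : ∀ {u v : V}, u ∈ p₁.support → v ∈ p₁.support → s(u, v) ∉ w₁.edges → ¬ G.Adj u v :=
    fun hu hv h huv => h ((hes₁ _).2 (hchord₁ hu hv huv))
  have hmem : ∀ {v : V}, v ∈ p₁.support ↔ v = y ∨ v = a ∨ v = b ∨ v = c ∨ v = d ∨ v = x := by
    simp [hsp]
  have hmeme : ∀ {e : Sym2 V}, e ∈ w₁.edges ↔ e = s(x, y) ∨ e = s(y, a) ∨ e = s(a, b) ∨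
      e = s(b, c) ∨ e = s(c, d) ∨ e = s(d, x) := by
    simp [hes₁, hepp]
  have hd := hnd
  simp only [List.nodup_cons, List.mem_cons, List.not_mem_nil, not_or, or_false] at hd
  obtain ⟨⟨dya, dyb, dyc, dyd, dyx⟩, ⟨dab, dac, dad, dax⟩, ⟨dbc, dbd, dbx⟩, ⟨dcd, dcx⟩, ddx, -⟩ := hd
  have ha : a ∉ p₂.support := fun h =>
    hcorner (Ne.symm dax) he₁ (hmeme.2 (by simp)) he₂ ((hes₂ _).2 (hchord₂ hy₂ h hya))
  have hd : d ∉ p₂.support := fun h =>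
    hcorner dyd (by rwa [Sym2.eq_swap]) (hmeme.2 (by simp [Sym2.eq_swap (a := d)]))
      (by rwa [Sym2.eq_swap]) ((hes₂ _).2 (hchord₂ hx₂ h hdx.symm))
  have hb : b ∉ p₂.support :=
    hnear.notMem (hN a (by simp)) hya hab
      (hne (hmem.2 (by simp)) (hmem.2 (by simp)) (by rw [hmeme]; simp; grind))
      (hne (hmem.2 (by simp)) (hmem.2 (by simp)) (by rw [hmeme]; simp; grind))
      (Ne.symm dyb) ha fun h => hreach h dbx (Ne.symm dyb)
  have hc : c ∉ p₂.support :=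
    hnear.notMem (hN d (by simp)) hdx.symm hcd.symm
      (hne (hmem.2 (by simp)) (hmem.2 (by simp)) (by rw [hmeme]; simp; grind))
      (hne (hmem.2 (by simp)) (hmem.2 (by simp)) (by rw [hmeme]; simp; grind))
      dcx hd fun h => hreach' h dcx (Ne.symm dyc)
  have hinter : ∀ v, v ∈ p₁.support → v ∈ p₂.support → v = x ∨ v = y := by
    intro v hv₁ hv₂
    rcases hmem.1 hv₁ with rfl | rfl | rfl | rfl | rfl | rfl
    exacts [Or.inr rfl, (ha hv₂).elim, (hb hv₂).elim, (hc hv₂).elim, (hd hv₂).elim, Or.inl rfl]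
  have hcross : ∀ {u v : V}, u ∈ p₁.support → u ∉ p₂.support → v ∈ p₂.support →
      v ∉ p₁.support → ¬ G.Adj u v := by
    intro u v hu hu₂ hv hv₁
    have hvx : v ≠ x := fun h => hv₁ (h ▸ p₁.end_mem_support)
    have hvy : v ≠ y := fun h => hv₁ (h ▸ p₁.start_mem_support)
    have k := hnear.not_adj_of_reaches (hN a (by simp)) (hN b (by simp)) hya hab hbc hcd hdx hnd
      ha hb hc hd hv hvy (hreach hv hvx hvy)
    have k' := hnear.not_adj_of_reaches (hN d (by simp)) (hN c (by simp)) hdx.symm hcd.symm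
      hbc.symm hab.symm hya.symm hnd' hd hc hb ha hv hvx (hreach' hv hvx hvy)
    rcases hmem.1 hu with rfl | rfl | rfl | rfl | rfl | rfl
    exacts [(hu₂ hy₂).elim, k.1, k.2, k'.2, k'.1, (hu₂ hx₂).elim]
  refine ⟨?_, ?_, ⟨y, p₁.append p₂.reverse, ?_, ?_, ?_, s(x, y), ?_, ?_⟩, ?_⟩
  · ext e
    induction e using Sym2.ind with | _ u v => ?_
    simp only [Set.mem_inter_iff, Set.mem_ofPred_eq, Set.mem_singleton_iff]
    refine ⟨fun ⟨h₁, h₂⟩ => ?_, fun h => h ▸ ⟨he₁, he₂⟩⟩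
    have hu := hinter u ((hs₁ _).1 (w₁.fst_mem_support_of_mem_edges h₁))
      ((hs₂ _).1 (w₂.fst_mem_support_of_mem_edges h₂))
    have hv := hinter v ((hs₁ _).1 (w₁.snd_mem_support_of_mem_edges h₁))
      ((hs₂ _).1 (w₂.snd_mem_support_of_mem_edges h₂))
    have huv := (w₁.adj_of_mem_edges h₁).ne
    grind [Sym2.eq_swap]
  · ext v
    simp only [Set.mem_inter_iff, Set.mem_ofPred_eq, Set.mem_insert_iff, Set.mem_singleton_iff,
      hs₁, hs₂]
    refine ⟨fun h => hinter v h.1 h.2, ?_⟩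
    rintro (rfl | rfl)
    exacts [⟨p₁.end_mem_support, hx₂⟩, ⟨p₁.start_mem_support, hy₂⟩]
  · refine hp₁.isCycle_append hp₂.reverse (fun v hv₁ hv₂ => ?_) (Or.inl (by lia))
    have hy₁ : y ∉ p₁.support.tail := by
      have := hp₁.support_nodup
      rw [← p₁.cons_tail_support, List.nodup_cons] at this
      exact this.1
    have hx₂' : x ∉ p₂.reverse.support.tail := by
      have := hp₂.reverse.support_nodup
      rw [← p₂.reverse.cons_tail_support, List.nodup_cons] at this
      exact this.1
    rcases hinter v (List.mem_of_mem_tail hv₁)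
      (by simpa using List.mem_of_mem_tail hv₂) with rfl | rfl
    exacts [hx₂' hv₂, hy₁ hv₁]
  · simp [Walk.mem_support_append_iff, hs₁, hs₂]
  · exact fun e he => Walk.edges_subset_edgeSet _ he
  · refine ⟨hxy, fun z hz => ?_, by simp [hep₁, hep₂]⟩
    rcases Sym2.mem_iff.1 hz with rfl | rfl
    exacts [Or.inl (w₁.fst_mem_support_of_mem_edges he₁),
      Or.inl (w₁.snd_mem_support_of_mem_edges he₁)]
  · intro e
    induction e using Sym2.ind with | _ u v => ?_
    rintro ⟨huv, hz, he⟩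
    have hu := hz u (Sym2.mem_mk_left u v)
    have hv := hz v (Sym2.mem_mk_right u v)
    rw [mem_edgeSet] at huv
    rw [hs₁, hs₂] at hu hv
    simp only [Walk.edges_append, Walk.edges_reverse, List.mem_append, List.mem_reverse,
      not_or] at he
    by_cases h₁ : u ∈ p₁.support ∧ v ∈ p₁.support
    · exact (hchord₁ h₁.1 h₁.2 huv).resolve_right he.1
    by_cases h₂ : u ∈ p₂.support ∧ v ∈ p₂.support
    · exact (hchord₂ h₂.1 h₂.2 huv).resolve_right he.2
    by_cases h₃ : u ∈ p₁.support
    · have hv₁ : v ∉ p₁.support := fun h => h₁ ⟨h₃, h⟩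
      have hv₂ := hv.resolve_left hv₁
      exact (hcross h₃ (fun h => h₂ ⟨h, hv₂⟩) hv₂ hv₁ huv).elim
    · have hu₂ := hu.resolve_left h₃
      have hv₂ : v ∉ p₂.support := fun h => h₂ ⟨hu₂, h⟩
      exact (hcross (hv.resolve_right hv₂) hv₂ hu₂ h₃ huv.symm).elim
  · intro z hz hzx hzy r w hw hl hzw
    have hz₁ := (hs₁ z).1 hz
    exact (hinter z hz₁ ((hnear w hw hl z hzw (Or.inl hz₁) z).1 hzw)).elim hzx hzy

end NormalAdjacency

/-- In a minimal counterexample `(G, C0, φ0)` to the extension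
theorem, embedded in the plane so that the chordless cycle `C0` bounds the
outer face `D`: if a `6`-face `f1` and a face `f2` of length at most `5` (both
distinct from the outer face) share a common edge `xy`, then they are normally
adjacent, the subgraph induced by `V(f1) ∪ V(f2)` is a cycle with a unique
chord, and no vertex of `V(f1) \ {x, y}` lies on a cycle of length at most
`5`. -/
theorem six_face_meets_small_face {V : Type} [Fintype V] (G : SimpleGraph V)
    {v0 : V} (C0 : G.Walk v0 v0) (φ0 : V → Bool)
    (hmin : IsMinimalCounterexample G C0 φ0)
    (vtx : V → ℝ × ℝ) (arc : V → V → ℝ → ℝ × ℝ)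
    (hemb : IsPlaneEmbedding G vtx arc)
    (hchordless : Chordless G C0)
    (D : Set (ℝ × ℝ)) (hD : IsOuterFace G vtx arc D)
    (hbound : frontier D = WalkDrawing G arc C0)
    -- `f1` is a 6-face with boundary cycle `w1`, distinct from the outer face:
    {a : V} (w1 : G.Walk a a) (f1 : Set (ℝ × ℝ))
    (hw1 : w1.IsCycle) (hl1 : w1.length = 6)
    (hf1 : FaceBoundedBy G vtx arc f1 w1) (hf1D : f1 ≠ D)
    -- `f2` is a face of length at most 5 with boundary cycle `w2`, distinct
    -- from the outer face:
    {b : V} (w2 : G.Walk b b) (f2 : Set (ℝ × ℝ))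
    (hw2 : w2.IsCycle) (hl2 : w2.length ≤ 5)
    (hf2 : FaceBoundedBy G vtx arc f2 w2) (hf2D : f2 ≠ D)
    (hne : f1 ≠ f2)
    -- `f1` and `f2` share the common edge `xy`:
    (x y : V) (hxy : G.Adj x y)
    (he1 : s(x, y) ∈ w1.edges) (he2 : s(x, y) ∈ w2.edges) :
    -- they are normally adjacent:
    ({e : Sym2 V | e ∈ w1.edges} ∩ {e : Sym2 V | e ∈ w2.edges} = {s(x, y)}) ∧
    ({z : V | z ∈ w1.support} ∩ {z : V | z ∈ w2.support} = {x, y}) ∧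
    -- `G[V(f1) ∪ V(f2)]` is a cycle with a unique chord:
    (∃ (r : V) (c : G.Walk r r), c.IsCycle ∧
      (∀ z : V, z ∈ c.support ↔ (z ∈ w1.support ∨ z ∈ w2.support)) ∧
      (∀ e ∈ c.edges, e ∈ G.edgeSet) ∧
      (∃! e : Sym2 V, e ∈ G.edgeSet ∧
        (∀ z ∈ e, z ∈ w1.support ∨ z ∈ w2.support) ∧ e ∉ c.edges)) ∧
    -- no vertex of `V(f1) \ {x, y}` is on a cycle of length at most 5:
    (∀ z ∈ w1.support, z ≠ x → z ≠ y →
      ∀ (r : V) (cw : G.Walk r r), cw.IsCycle → cw.length ≤ 5 →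
        z ∉ cw.support) := by
  refine hmin.1.2.1.hexagon_normally_adjacent hw1 hw2 hl1 hl2 hxy he1 he2 ?_
  intro u v t hut hu1 ht1 hu2 ht2
  by_cases hv : v ∈ C0.support
  · obtain ⟨s, hs⟩ := (IsCycle.mem_support_iff_exists_edge hmin.1.2.2.1.1).1 hv
    exact notMem_frontier_of_shared_corner hemb hut hw1 hw2 hf1 hf2 hne hu1 ht1 hu2 ht2 hD.1 hf1D
      hf2D (hbound ▸ vtx_mem_walkDrawing hemb hs)
  · obtain ⟨s, hvs, hsu, hst⟩ :=
      hmin.exists_third_neighbor hv (w1.adj_of_mem_edges hu1) hw1 ht1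
    exact (eq_or_eq_of_shared_corner hemb hut hw1 hw2 hf1 hf2 hne hu1 ht1 hu2 ht2 hvs).elim
      hsu hst

end IFPaper
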